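/- Let C_n denote the number of quarter-plane walks of length n with steps from 𝒞 = {(−1,1),(0,1),(1,1),(1,0),(1,−1)}, and let C(t) = Σ_{n≥0} C_n t^n be the associated formal power series over ℚ. Then C(t) is not D-finite: there do not exist a natural number r and polynomials p_0,…,p_r ∈ ℚ[t], not all zero, such that Σ_{i=0}^r p_i(t)·C^{(i)}(t) = 0 as formal power series. -/

import Mathlib

/-- The number of quarter-plane walks of length `n` with steps from `S`:
sequences of `n` steps, each in `S`, all of whose partial sums have both
coordinates nonnegative. -/
noncomputable def quarterPlaneWalks (S : Finset (ℤ × ℤ)) (n : ℕ) : ℕ :=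
  Nat.card {f : Fin n → ℤ × ℤ //
    (∀ k, f k ∈ S) ∧
    ∀ k : Fin n, 0 ≤ ∑ j ∈ Finset.Iic k, (f j).1 ∧ 0 ≤ ∑ j ∈ Finset.Iic k, (f j).2}

/-- The counting generating function of quarter-plane walks with steps
from `S`, as a formal power series over ℚ. -/
noncomputable def walkGF (S : Finset (ℤ × ℤ)) : PowerSeries ℚ :=
  PowerSeries.mk fun n => (quarterPlaneWalks S n : ℚ)



/-- The reciprocal iterates of the kernel root. -/
def seqU {R : Type*} [CommRing R] (v T : R) : ℕ → R
  | 0 => 1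
  | 1 => v
  | (n+2) => T * seqU v T (n+1) - 1 - seqU v T n

theorem seqU_zero {R : Type*} [CommRing R] (v T : R) : seqU v T 0 = 1 := rfl
theorem seqU_one {R : Type*} [CommRing R] (v T : R) : seqU v T 1 = v := rfl
theorem seqU_succ {R : Type*} [CommRing R] (v T : R) (n : ℕ) :
    seqU v T (n+2) = T * seqU v T (n+1) - 1 - seqU v T n := rfl

theorem seqU_inv {R : Type*} [CommRing R] (v T : R) (h : v^2 + v + 3 = T * v) (n : ℕ) :
    seqU v T n ^ 2 + seqU v T (n+1) ^ 2 + seqU v T n + seqU v T (n+1) + 1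
      = T * (seqU v T n * seqU v T (n+1)) := by
  induction n with
  | zero => simp only [seqU_zero, seqU_one, zero_add]; linear_combination h
  | succ n ih => rw [seqU_succ]; linear_combination ih

theorem seqU_prod {R : Type*} [CommRing R] (v T : R) (h : v^2 + v + 3 = T * v) (n : ℕ) :
    seqU v T n * seqU v T (n+2) = seqU v T (n+1) ^ 2 + seqU v T (n+1) + 1 := by
  rw [seqU_succ]; linear_combination -seqU_inv v T h n

theorem seqU_closed {v T q a b c : ℂ} (hq : q ≠ 0) (hT : q + q⁻¹ = T) (hc : c * (T - 2) = 1)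
    (h0 : a + b + c = 1) (h1 : a * q⁻¹ + b * q + c = v) (n : ℕ) :
    seqU v T n = a * q⁻¹ ^ n + b * q ^ n + c := by
  have key : ∀ n, seqU v T n = a * q⁻¹ ^ n + b * q ^ n + c ∧
      seqU v T (n+1) = a * q⁻¹ ^ (n+1) + b * q ^ (n+1) + c := by
    intro n
    induction n with
    | zero => simp only [seqU_zero, seqU_one, zero_add, pow_zero, pow_one, mul_one]
              exact ⟨h0.symm, h1.symm⟩
    | succ n ih =>
      refine ⟨ih.2, ?_⟩
      rw [seqU_succ, ih.1, ih.2]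
      have e : q * q⁻¹ = 1 := mul_inv_cancel₀ hq
      rw [← hT] at hc ⊢
      simp only [pow_succ]
      linear_combination (a * q⁻¹ ^ n + b * q ^ n) * e + hc
  exact (key n).1

/-- nonvanishing on the arcs -/
theorem seqU_arc_ne {v : ℂ} {T : ℝ} (hv : v.im ≠ 0) (h1 : -2 ≤ T) (h2 : T ≤ 2) (n : ℕ) :
    seqU v (T:ℂ) n ≠ 0 := by
  -- β n : Chebyshev, α n
  let β : ℕ → ℝ := fun n => seqU (R := ℝ) 2 T n - seqU (R := ℝ) 1 T n
  let α : ℕ → ℝ := fun n => seqU (R := ℝ) 0 T n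
  have hβ0 : β 0 = 0 := by simp [β, seqU_zero]
  have hβ1 : β 1 = 1 := by simp [β, seqU_one]; norm_num
  have hβs : ∀ n, β (n+2) = T * β (n+1) - β n := by intro n; simp only [β, seqU_succ]; ring
  have hα0 : α 0 = 1 := by simp [α, seqU_zero]
  have hα1 : α 1 = 0 := by simp [α, seqU_one]
  have hαs : ∀ n, α (n+2) = T * α (n+1) - 1 - α n := by intro n; simp only [α, seqU_succ]
  have hu : ∀ n, seqU v (T:ℂ) n = α n + β n * v ∧ seqU v (T:ℂ) (n+1) = α (n+1) + β (n+1) * v := by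
    intro n
    induction n with
    | zero => simp [hα0, hβ0, hα1, hβ1, seqU_zero, seqU_one]
    | succ n ih =>
      refine ⟨ih.2, ?_⟩
      rw [seqU_succ, ih.1, ih.2, hαs, hβs]; push_cast; ring
  have hinv : ∀ n, β n ^ 2 + β (n+1) ^ 2 - T * (β n * β (n+1)) = 1 := by
    intro n
    induction n with
    | zero => simp [hβ0, hβ1]
    | succ n ih => rw [hβs]; linear_combination ih
  have hrel : ∀ n, (T - 2) * α (n+1) = 1 - β (n+1) - (T - 3) * β n ∧
      (T - 2) * α (n+2) = 1 - β (n+2) - (T - 3) * β (n+1) := by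
    intro n
    induction n with
    | zero => rw [hαs, hβs]; simp only [zero_add]; rw [hα0, hα1, hβ0, hβ1]; constructor <;> ring
    | succ n ih =>
      refine ⟨ih.2, ?_⟩
      rw [hαs, hβs (n+1)]
      have e := hβs n
      linear_combination T * ih.2 - ih.1 + (T-3) * e
  intro h0
  rcases n with _ | n
  · simp [seqU_zero] at h0
  rw [(hu n).2] at h0
  have him := congrArg Complex.im h0
  have hre := congrArg Complex.re h0
  simp at him hre
  have hb : β (n+1) = 0 := by
    rcases him with h | h
    · exact h
    · exact absurd h hv
  rw [hb] at hre
  have ha : α (n+1) = 0 := by simpa using hre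
  have r := (hrel n).1
  have i := hinv n
  rw [hb] at r i
  rw [ha] at r
  by_cases hT : T = 2
  · have : ∀ n, β n = n ∧ β (n+1) = n + 1 := by
      intro n
      induction n with
      | zero => simp [hβ0, hβ1]
      | succ n ih => refine ⟨by rw [ih.2]; push_cast; ring, ?_⟩
                     rw [hβs, ih.1, ih.2, hT]; push_cast; ring
    have h3 := (this n).2
    rw [hb] at h3
    have : (0:ℝ) ≤ n := Nat.cast_nonneg n
    linarith
  · have : β n = 1 ∨ β n = -1 := by
      have : (β n - 1) * (β n + 1) = 0 := by linear_combination i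
      rcases mul_eq_zero.1 this with h | h
      · left; linarith
      · right; linarith
    rcases this with h | h <;> rw [h] at r
    · linarith
    · apply hT; linarith

open Polynomial in
/-- polynomial version of the sequence -/
noncomputable def polU : ℕ → ℂ[X]
  | 0 => 1
  | 1 => 1
  | (n+2) => (1 + X + 3 * X^2) * polU (n+1) - X^(n+2) - X^2 * polU n

open Polynomial in
theorem polU_succ (n : ℕ) : polU (n+2) = (1 + X + 3 * X^2) * polU (n+1) - X^(n+2) - X^2 * polU n := rfl

theorem polU_eval {s : ℂ} (hs : s ≠ 0) (n : ℕ) :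
    (polU n).eval s = s ^ n * seqU s⁻¹ (s⁻¹ + 1 + 3 * s) n := by
  have key : ∀ n, (polU n).eval s = s ^ n * seqU s⁻¹ (s⁻¹ + 1 + 3 * s) n ∧
      (polU (n+1)).eval s = s ^ (n+1) * seqU s⁻¹ (s⁻¹ + 1 + 3 * s) (n+1) := by
    intro n
    induction n with
    | zero => simp [polU, seqU, hs]
    | succ n ih =>
      refine ⟨ih.2, ?_⟩
      rw [polU_succ, seqU_succ]
      simp only [Polynomial.eval_sub, Polynomial.eval_mul, Polynomial.eval_add, Polynomial.eval_one, Polynomial.eval_X, Polynomial.eval_pow,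
        Polynomial.eval_ofNat, ih.1, ih.2]
      field_simp
      ring
  exact (key n).1

theorem polU_eval_zero (n : ℕ) : (polU n).eval 0 = 1 := by
  have key : ∀ n, (polU n).eval 0 = 1 ∧ (polU (n+1)).eval 0 = 1 := by
    intro n
    induction n with
    | zero => simp [polU]
    | succ n ih =>
      refine ⟨ih.2, ?_⟩
      rw [polU_succ]
      simp [ih.2]
  exact (key n).1

theorem polU_ne_zero (n : ℕ) : polU n ≠ 0 := by
  intro h; have := polU_eval_zero n; rw [h] at this; simp at this

open Polynomial in
theorem polU_deg (n : ℕ) : (polU (n+2)).natDegree ≤ 2*n+2 ∧ (polU (n+2)).coeff (2*n+2) = 3^n := by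
  have d1 : (1 + X + 3 * X^2 : ℂ[X]).natDegree ≤ 2 := by compute_degree
  have c1 : (1 + X + 3 * X^2 : ℂ[X]).coeff 2 = 3 := by
    simp [coeff_X, coeff_one]
  have key : ∀ n, ((polU (n+1)).natDegree ≤ 2*n) ∧ ((polU (n+2)).natDegree ≤ 2*n+2) ∧ (polU (n+2)).coeff (2*n+2) = 3^n := by
    intro n
    induction n with
    | zero =>
      have : polU 2 = (1 + X + X^2 : ℂ[X]) := by
        rw [polU_succ]; simp only [polU]; ring
      refine ⟨by simp [polU], ?_, ?_⟩
      · simp only [zero_add, mul_zero]; rw [this]; compute_degree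
      · simp only [zero_add, mul_zero]; rw [this]; simp [coeff_X, coeff_one]
    | succ n ih =>
      obtain ⟨i1, i2, i3⟩ := ih
      refine ⟨by simpa [mul_add] using i2, ?_, ?_⟩
      · rw [polU_succ]
        refine (natDegree_sub_le_of_le (natDegree_sub_le_of_le (natDegree_mul_le_of_le d1 i2) (natDegree_X_pow_le _)) (natDegree_mul_le_of_le (natDegree_X_pow_le _) i1)).trans ?_
        simp only [sup_le_iff]; omega
      · rw [polU_succ, coeff_sub, coeff_sub]
        have e1 : ((1 + X + 3 * X^2) * polU (n+2)).coeff (2*(n+1)+2) = 3 * 3^n := by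
          rw [show 2*(n+1)+2 = 2 + (2*n+2) by ring, coeff_mul_add_eq_of_natDegree_le d1 i2, c1, i3]
        have e2 : (X^(n+1+2) : ℂ[X]).coeff (2*(n+1)+2) = 0 := by
          rw [coeff_X_pow, if_neg (by omega)]
        have e3 : (X^2 * polU (n+1)).coeff (2*(n+1)+2) = 0 := by
          apply coeff_eq_zero_of_natDegree_lt
          refine lt_of_le_of_lt (natDegree_mul_le_of_le (natDegree_X_pow_le _) i1) (by omega)
        rw [e1, e2, e3]; ring
  exact (key n).2

theorem seqU_six {v : ℂ} (n : ℕ) : seqU v 1 (6 * n) = 1 := by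
  have key : ∀ n, seqU v 1 (6*n) = 1 ∧ seqU v 1 (6*n+1) = v := by
    intro n
    induction n with
    | zero => simp [seqU]
    | succ n ih =>
      have e2 : seqU v 1 (6*n+2) = v - 2 := by rw [seqU_succ, ih.1, ih.2]; ring
      have e3 : seqU v 1 (6*n+3) = -3 := by rw [seqU_succ v 1 (6*n+1), ih.2, e2]; ring
      have e4 : seqU v 1 (6*n+4) = -v-2 := by rw [seqU_succ v 1 (6*n+2), e3, e2]; ring
      have e5 : seqU v 1 (6*n+5) = -v := by rw [seqU_succ v 1 (6*n+3), e4, e3]; ring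
      have e6 : seqU v 1 (6*n+6) = 1 := by rw [seqU_succ v 1 (6*n+4), e5, e4]; ring
      have e7 : seqU v 1 (6*n+7) = v := by rw [seqU_succ v 1 (6*n+5), e6, e5]; ring
      exact ⟨e6, e7⟩
  exact (key n).1

theorem polU_eval_sigma {σ : ℂ} (h : 3 * σ^2 = -1) (n : ℕ) : (polU (6*n)).eval σ = σ^(6*n) := by
  have h0 : σ ≠ 0 := by rintro rfl; norm_num at h
  rw [polU_eval h0]
  have : σ⁻¹ + 1 + 3 * σ = 1 := by field_simp; linear_combination h
  rw [this, seqU_six, mul_one]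

open Polynomial in
theorem polU_exists_root (j : ℕ) : ∃ s : ℂ, s ≠ 0 ∧ (polU (6*(j+1))).eval s = 0 ∧ 1 ≤ ‖s⁻¹ + 3 * s‖ := by
  by_contra hcon
  push Not at hcon
  set n := 6*j+4 with hn
  set p := polU (6*(j+1)) with hp
  have hpn : p = polU (n+2) := by rw [hp, hn]; congr 1
  have hp0 : p ≠ 0 := polU_ne_zero _
  have hd := polU_deg n
  rw [← hpn] at hd
  have hdeg : p.natDegree = 2*n+2 := by
    apply le_antisymm hd.1
    apply le_natDegree_of_ne_zero
    rw [hd.2]; exact pow_ne_zero _ (by norm_num)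
  have hlead : p.leadingCoeff = 3^n := by rw [leadingCoeff, hdeg, hd.2]
  have hsplit : p.Splits := IsAlgClosed.splits p
  have hev : ∀ z, p.eval z = 3^n * (p.roots.map (fun a => z - a)).prod := by
    intro z
    rw [hsplit.eval_eq_prod_roots, hlead]
  have hcard : p.roots.card = 2*n+2 := by rw [← hdeg]; exact hsplit.natDegree_eq_card_roots.symm
  set σ : ℂ := Complex.I * ((Real.sqrt 3)⁻¹ : ℝ) with hσ
  have hσ2 : 3 * σ^2 = -1 := by
    have : ((Real.sqrt 3)⁻¹ : ℝ)^2 = 1/3 := by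
      rw [inv_pow, Real.sq_sqrt (by norm_num)]; norm_num
    have h2 : (((Real.sqrt 3)⁻¹ : ℝ) : ℂ)^2 = 1/3 := by rw [← Complex.ofReal_pow, this]; norm_num
    rw [hσ, mul_pow, Complex.I_sq, h2]; norm_num
  have e1 : p.eval σ = σ^(6*(j+1)) := polU_eval_sigma hσ2 _
  have e2 : p.eval (-σ) = (-σ)^(6*(j+1)) := polU_eval_sigma (by rw [neg_sq]; exact hσ2) _
  have e0 : p.eval 0 = 1 := polU_eval_zero _
  -- product identity
  have hprod : (p.roots.map (fun a => 1 + 3 * a^2)).prod * (3:ℂ)^(2*n) = 3^(2*n+2) * (p.eval σ * p.eval (-σ)) := by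
    rw [hev, hev]
    have : (p.roots.map (fun a => 1 + 3 * a^2)) = (p.roots.map (fun a => 3 * ((σ - a) * ((-σ) - a)))) := by
      apply Multiset.map_congr rfl; intro a _; linear_combination hσ2
    rw [this, Multiset.prod_map_mul, Multiset.prod_map_mul, Multiset.map_const', Multiset.prod_replicate, hcard]
    ring
  have hprod2 : (p.roots.map (fun a => 1 + 3 * a^2)).prod * (3:ℂ)^(2*n) = 3^n := by
    rw [hprod, e1, e2]
    have : σ^(6*(j+1)) * (-σ)^(6*(j+1)) * (3:ℂ)^(n+2) = 1 := by
      rw [← mul_pow, show 6*(j+1) = n+2 by omega, ← mul_pow]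
      rw [show σ * -σ * 3 = 1 by linear_combination -hσ2, one_pow]
    calc (3:ℂ)^(2*n+2) * (σ^(6*(j+1)) * (-σ)^(6*(j+1))) = 3^n * (σ^(6*(j+1)) * (-σ)^(6*(j+1)) * (3:ℂ)^(n+2)) := by ring
      _ = _ := by rw [this, mul_one]
  have hprod3 : (p.roots.map (fun a => -a)).prod * 3^n = 1 := by
    rw [← e0, hev]; simp only [zero_sub]; ring
  have h3 : (3:ℂ)^n ≠ 0 := pow_ne_zero _ (by norm_num)
  have hprod4 : (p.roots.map (fun a => 1 + 3 * a^2)).prod = (p.roots.map (fun a => -a)).prod := by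
    apply mul_right_cancel₀ (mul_ne_zero h3 h3)
    rw [← mul_assoc (p.roots.map (fun a => -a)).prod, hprod3, one_mul]
    refine Eq.trans ?_ hprod2; ring
  have hnorm : ∀ m : Multiset ℂ, (∀ a ∈ m, a ≠ 0 ∧ ‖1 + 3 * a^2‖ < ‖-a‖) → m ≠ 0 →
      ‖(m.map (fun a => 1 + 3 * a^2)).prod‖ < ‖(m.map (fun a => -a)).prod‖ := by
    intro m
    induction m using Multiset.induction_on with
    | empty => intro _ h; exact absurd rfl h
    | cons a m ih =>
      intro h _
      rw [Multiset.map_cons, Multiset.map_cons, Multiset.prod_cons, Multiset.prod_cons, norm_mul, norm_mul]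
      have ha := h a (Multiset.mem_cons_self a m)
      by_cases hm : m = 0
      · subst hm; simpa using ha.2
      · have := ih (fun b hb => h b (Multiset.mem_cons_of_mem hb)) hm
        exact mul_lt_mul'' ha.2 this (norm_nonneg _) (norm_nonneg _)
  have hne : p.roots ≠ 0 := by
    intro h; rw [h] at hcard; simp at hcard
  have := hnorm p.roots (by
    intro a ha
    have hr : p.eval a = 0 := (mem_roots hp0).1 ha
    have ha0 : a ≠ 0 := by rintro rfl; rw [e0] at hr; exact one_ne_zero hr
    refine ⟨ha0, ?_⟩
    have := hcon a ha0 hr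
    have e : 1 + 3 * a^2 = (a⁻¹ + 3 * a) * a := by field_simp
    rw [e, norm_mul, norm_neg]
    have hpos : 0 < ‖a‖ := norm_pos_iff.2 ha0
    nlinarith) hne
  rw [hprod4] at this
  exact lt_irrefl _ this


/-- odd case algebra -/
theorem cancel_odd {a b c T D h α β c' x y k : ℂ} (hh : h ≠ 0) (hD : D^2 = T^2 - 4)
    (hT2 : T - 2 ≠ 0) (hTm : T + 2 ≠ 0) (hT1 : T - 1 ≠ 0)
    (hc : c * (T - 2) = 1) (hab : a * b * (T^2 - 4) = 1 + c)
    (hc' : c' * (T - 2) + c * (D * h) = 0)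
    (hK : (α + β) * (a * b) * (T^2 - 4) + a * b * (2 * T * (D * h)) = c')
    (hx : x + y = -c) (hxy : x * y = a * b)
    (hz : (α * y + β * x + c') + (α * x + β * y + c') + k * h * (y - x) = 0) :
    9 = -3 * k^2 * (T - 1)^2 := by
  have hDn : D ≠ 0 := by
    intro h0; rw [h0] at hD
    have : (T - 2) * (T + 2) = 0 := by linear_combination -hD
    rcases mul_eq_zero.1 this with h | h
    · exact hT2 h
    · exact hTm h
  have c1 : 1 + c = (T - 1) * c := by linear_combination -hc
  have hcn : c ≠ 0 := by rintro rfl; simp at hc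
  have c2 : c' = - c^2 * D * h := by
    apply mul_right_cancel₀ hT2
    linear_combination hc' + c * D * h * hc
  -- (y-x)^2 D^2 = -3
  have hd : ((y - x) * D)^2 = -3 := by
    have : ((y - x) * D)^2 = (c^2 - 4 * (a*b)) * D^2 := by
      have : (y-x)^2 = c^2 - 4*(a*b) := by linear_combination (x + y - c) * hx - 4 * hxy
      rw [mul_pow, this]
    rw [this, hD]
    linear_combination -4 * hab + (c * (T+2) + 1) * hc - c * hc + c * hc
  -- K (T-1) c D^2
  have hK2 : (α + β) * (1 + c) * D + (1 + c) * (2 * T * h) = c' * D := by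
    apply mul_right_cancel₀ hDn
    linear_combination (T^2-4) * hK + ((α+β) * (1+c) - c') * hD - ((α + β) * (T^2-4) + 2 * T * D * h) * hab
  have key : k * ((y - x) * D) * (T - 1) = 3 := by
    have hz2 : (α+β) * (-c) + 2 * c' + k * h * (y - x) = 0 := by rw [← hx]; linear_combination hz
    apply mul_right_cancel₀ (mul_ne_zero hh hcn)
    have e : (1+c) * (k * h * ((y - x)*D)) = c * (c' * D - (1+c) * (2*T*h)) - 2 * c' * D * (1+c) := by
      linear_combination (1+c) * D * hz2 + c * hK2
    rw [c1, c2] at e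
    have hcT : c * T = 1 + 2 * c := by linear_combination hc
    have e2 : (k * h * ((y - x)*D)) * (T - 1) = c * ( - c * D^2 * h - (T-1) * (2*T*h)) + 2 * c * D^2*h * (T-1) * c := by
      apply mul_left_cancel₀ hcn
      linear_combination e
    rw [hD] at e2
    have h4 : c * (T^2 - 4) = T + 2 := by linear_combination (T+2) * hc
    linear_combination c * e2 + (-c^2*h + 2*c^2*h*(T-1)) * h4 + 3 * c * h * hc
  have : (k * ((y - x) * D) * (T - 1))^2 = 9 := by rw [key]; norm_num
  rw [← this, mul_pow, mul_pow, hd]; ring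

theorem cancel_even {a b c T D h α β c' x y N : ℂ} (hh : h ≠ 0) (hD : D^2 = T^2 - 4)
    (hT2 : T - 2 ≠ 0) (hTm : T + 2 ≠ 0) (hT1 : T - 1 ≠ 0)
    (hc : c * (T - 2) = 1) (h0 : a + b + c = 1) (hab : a * b * (T^2 - 4) = 1 + c)
    (hc' : c' * (T - 2) + c * (D * h) = 0)
    (h0' : a * α + b * β + c' = 0)
    (hK : (α + β) * (a * b) * (T^2 - 4) + a * b * (2 * T * (D * h)) = c')
    (hxy : y - x ≠ 0)
    (hz : (α - β) * (y - x) - N * h * (y - x) = 0) :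
    N^2 * (T-1)^2 * ((T-1)^2 - 12) = (2 * (T-1)^2 + 3 * (T-1) + 6)^2 := by
  have hDn : D ≠ 0 := by
    intro h0; rw [h0] at hD
    have : (T - 2) * (T + 2) = 0 := by linear_combination -hD
    rcases mul_eq_zero.1 this with h | h
    · exact hT2 h
    · exact hTm h
  have c1 : 1 + c = (T - 1) * c := by linear_combination -hc
  have hcn : c ≠ 0 := by rintro rfl; simp at hc
  have c2 : c' = - c^2 * D * h := by
    apply mul_right_cancel₀ hT2
    linear_combination hc' + c * D * h * hc
  have hd : ((a - b) * D)^2 = (1-c)^2 * (T^2-4) - 4 * (1 + c) := by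
    have : (a-b)^2 = (1-c)^2 - 4*(a*b) := by linear_combination (a + b + 1 - c) * h0
    rw [mul_pow, this, hD]; linear_combination -4 * hab
  have hK2 : (α + β) * (1 + c) * D + (1 + c) * (2 * T * h) = c' * D := by
    apply mul_right_cancel₀ hDn
    linear_combination (T^2-4) * hK + ((α+β) * (1+c) - c') * hD - ((α + β) * (T^2-4) + 2 * T * D * h) * hab
  have hN : α - β = N * h := by
    apply mul_right_cancel₀ hxy; linear_combination hz
  have hm : (α + β) * (1 - c) + N * h * (a - b) + 2 * c' = 0 := by
    rw [← hN]; linear_combination 2 * h0' - (α+β) * h0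
  have e : (1+c) * (N * h * ((a - b)*D)) = - (1-c) * (c' * D - (1+c) * (2*T*h)) - 2 * c' * D * (1+c) := by
      linear_combination (1+c) * D * hm - (1-c) * hK2
  have e2 : (1+c) * (N * ((a - b)*D)) = (1-c) * (c^2 * (T^2-4) + (1+c) * (2*T)) + 2 * c^2 * (T^2-4) * (1+c) := by
    apply mul_left_cancel₀ hh
    rw [c2] at e
    linear_combination e + h*c^2*((1-c) + 2 * (1+c)) * hD
  have e3 : ((1+c) * (N * ((a - b)*D)))^2 = ((1-c) * (c^2 * (T^2-4) + (1+c) * (2*T)) + 2 * c^2 * (T^2-4) * (1+c))^2 := by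
    rw [e2]
  have h4 : c^2 * (T^2 - 4) = 1 + 4 * c := by linear_combination (c * (T+2) + 1) * hc
  have hcT : c * T = 1 + 2 * c := by linear_combination hc
  rw [mul_pow, mul_pow, hd, h4, show 2 * c^2 * (T^2-4) * (1+c) = 2 * (1 + 4 * c) * (1+c) by rw [← h4]; ring] at e3
  have hcv : T = 2 + 1 / c := by field_simp; linear_combination hcT
  subst hcv
  field_simp
  field_simp at e3
  ring_nf at e3 ⊢
  linear_combination e3

theorem norm_inv_pow_le {q z : ℂ} (hq : ‖q‖ < 1) (n : ℕ) (h : q^n + q⁻¹^n = z) :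
    (‖q‖⁻¹)^n ≤ ‖z‖ + 1 := by
  have h1 : q⁻¹^n = z - q^n := by rw [← h]; ring
  have h2 : ‖q⁻¹^n‖ ≤ ‖z‖ + ‖q^n‖ := by rw [h1]; exact norm_sub_le _ _
  rw [norm_pow, norm_pow, norm_inv] at h2
  have : ‖q‖^n ≤ 1 := pow_le_one₀ (norm_nonneg _) hq.le
  linarith

theorem bad_estimate {q τ : ℂ} {k N : ℕ} (hq0 : q ≠ 0) (hq : ‖q‖ < 1) (hτ : 1 ≤ ‖τ‖)
    (hT : q + q⁻¹ = τ + 1) (hk : 2 ≤ k) (hN : 500 ≤ N)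
    (hCk : q^k + q⁻¹^k = 3 / τ - 1) (hCN : q^N + q⁻¹^N = τ^2 - τ - 10 + 12 / τ)
    (hbad : (N:ℂ)^2 * τ^2 * (τ^2 - 12) = (2*τ^2 + 3*τ + 6)^2) : False := by
  set x := ‖q‖⁻¹ with hx
  have hq' : 0 < ‖q‖ := norm_pos_iff.2 hq0
  have hx1 : 1 < x := (one_lt_inv₀ hq').2 hq
  have hτ0 : τ ≠ 0 := by rintro rfl; simp at hτ; linarith
  have hdiv : ∀ r : ℝ, 0 ≤ r → ‖(r:ℂ) / τ‖ ≤ r := by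
    intro r hr
    rw [norm_div, Complex.norm_real, Real.norm_of_nonneg hr]
    exact div_le_self hr hτ
  have hd3 : ‖3 / τ‖ ≤ 3 := by simpa using hdiv 3 (by norm_num)
  have hd12 : ‖12 / τ‖ ≤ 12 := by simpa using hdiv 12 (by norm_num)
  have b1 : x^k ≤ 5 := by
    refine (norm_inv_pow_le hq k hCk).trans ?_
    have := norm_sub_le (3/τ) 1
    rw [norm_one] at this; linarith
  have b2 : x^2 ≤ 5 := (pow_le_pow_right₀ hx1.le hk).trans b1
  have b3 : x ≤ 3 := by nlinarith
  have hτx : ‖τ‖ ≤ x + 2 := by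
    have : τ = q + q⁻¹ - 1 := by rw [hT]; ring
    rw [this]
    have h1 := norm_sub_le (q+q⁻¹) 1
    have h2 := norm_add_le q q⁻¹
    rw [norm_one] at h1; rw [norm_inv, ← hx] at h2; linarith
  have ht5 : ‖τ‖ ≤ 5 := by linarith
  have b4 : x^N ≤ 53 := by
    refine (norm_inv_pow_le hq N hCN).trans ?_
    have h1 := norm_add_le (τ^2 - τ - 10) (12/τ)
    have h2 := norm_sub_le (τ^2 - τ) 10
    have h3 := norm_sub_le (τ^2) τ
    rw [norm_pow] at h3
    have : ‖(10:ℂ)‖ = 10 := by simp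
    nlinarith
  have b5 : x ≤ 1.2 := by
    by_contra hcon
    push Not at hcon
    have h1 : (1.2:ℝ)^N ≤ x^N := pow_le_pow_left₀ (by norm_num) hcon.le N
    have h2 := one_add_mul_le_pow (a := (0.2:ℝ)) (by norm_num) N
    have : (500:ℝ) ≤ N := by exact_mod_cast hN
    norm_num at h1 h2
    linarith
  have ht3 : ‖τ‖ ≤ 3.2 := by linarith
  have hl : 1 ≤ ‖τ^2 - 12‖ := by
    have h1 := norm_sub_norm_le (12:ℂ) (τ^2)
    rw [norm_sub_rev, norm_pow] at h1
    have : ‖(12:ℂ)‖ = 12 := by simp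
    nlinarith
  have hN' : (500:ℝ) ≤ N := by exact_mod_cast hN
  have e := congrArg norm hbad
  rw [norm_mul, norm_mul, norm_pow, norm_pow, norm_pow] at e
  have hNn : ‖(N:ℂ)‖ = N := by simp
  rw [hNn] at e
  have hr : ‖2*τ^2 + 3*τ + 6‖ ≤ 100 := by
    have h1 := norm_add_le (2*τ^2 + 3*τ) 6
    have h2 := norm_add_le (2*τ^2) (3*τ)
    rw [norm_mul, norm_mul, norm_pow] at h2
    have a2 : ‖(2:ℂ)‖ = 2 := by simp
    have a3 : ‖(3:ℂ)‖ = 3 := by simp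
    have a6 : ‖(6:ℂ)‖ = 6 := by simp
    rw [a2, a3] at h2
    nlinarith
  have hr2 : ‖2*τ^2 + 3*τ + 6‖^2 ≤ 100^2 := pow_le_pow_left₀ (norm_nonneg _) hr 2
  have l1 : (500:ℝ)^2 ≤ (N:ℝ)^2 := pow_le_pow_left₀ (by norm_num) hN' 2
  have l2 : (1:ℝ) ≤ ‖τ‖^2 := one_le_pow₀ hτ
  have l3 : (500:ℝ)^2 * 1 * 1 ≤ (N:ℝ)^2 * ‖τ‖^2 * ‖τ^2-12‖ := by gcongr
  rw [e] at l3
  norm_num at l3 hr2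
  linarith

open Filter Topology

/-- the uniformised inverse of t -/
noncomputable def TT (s : ℂ) : ℂ := s⁻¹ + 1 + 3 * s

/-- the domain of continuation -/
def Om : Set ℂ := {s | Complex.normSq s ≠ 1/3 ∨ 1/6 < s.re ∨ s.re < -1/2}

theorem Om_isOpen : IsOpen Om := by
  have h1 : IsOpen {s : ℂ | Complex.normSq s ≠ 1/3} := isOpen_ne_fun Complex.continuous_normSq continuous_const
  have h2 : IsOpen {s : ℂ | 1/6 < s.re} := isOpen_lt continuous_const Complex.continuous_re
  have h3 : IsOpen {s : ℂ | s.re < -1/2} := isOpen_lt Complex.continuous_re continuous_const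
  exact h1.union (h2.union h3)

theorem Om_isPreconnected : IsPreconnected Om := by
  have hB : IsPreconnected {s : ℂ | Complex.normSq s < 1/3} := by
    have : {s : ℂ | Complex.normSq s < 1/3} = Metric.ball (0:ℂ) (Real.sqrt (1/3)) := by
      ext s
      rw [mem_ball_zero_iff, Set.mem_ofPred_eq, Real.lt_sqrt (norm_nonneg _), Complex.normSq_eq_norm_sq]
    rw [this]; exact (convex_ball _ _).isPreconnected
  have hE : IsPreconnected {s : ℂ | 1/3 < Complex.normSq s} := by
    have : {s : ℂ | 1/3 < Complex.normSq s} = Complex.exp '' {z | Real.log (1/3) / 2 < z.re} := by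
      ext s
      simp only [Set.mem_ofPred_eq, Set.mem_image]
      constructor
      · intro h
        have h0 : s ≠ 0 := by rintro rfl; simp at h; linarith
        refine ⟨Complex.log s, ?_, Complex.exp_log h0⟩
        rw [Complex.log_re, div_lt_iff₀ (by norm_num), mul_comm]
        rw [Complex.normSq_eq_norm_sq] at h
        have := Real.log_lt_log (by norm_num) h
        rwa [Real.log_pow] at this
      · rintro ⟨z, hz, rfl⟩
        rw [Complex.normSq_eq_norm_sq, Complex.norm_exp, ← Real.exp_nat_mul]
        rw [← Real.log_lt_iff_lt_exp (by norm_num)]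
        rw [div_lt_iff₀ (by norm_num)] at hz
        push_cast; linarith
    rw [this]
    apply IsPreconnected.image
    · exact (convex_halfSpace_re_gt _).isPreconnected
    · exact Complex.continuous_exp.continuousOn
  have hP : IsPreconnected {s : ℂ | 1/6 < s.re} := (convex_halfSpace_re_gt _).isPreconnected
  have hM : IsPreconnected {s : ℂ | s.re < -1/2} := (convex_halfSpace_re_lt _).isPreconnected
  have u1 := IsPreconnected.union (1/3 : ℂ) (s := {s : ℂ | Complex.normSq s < 1/3}) (t := {s : ℂ | 1/6 < s.re})
    (by simp [Complex.normSq_apply]; norm_num) (by simp; norm_num) hB hP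
  have u2 := IsPreconnected.union (1 : ℂ) (t := {s : ℂ | 1/3 < Complex.normSq s})
    (Or.inr (by simp; norm_num)) (by simp; norm_num) u1 hE
  have u3 := IsPreconnected.union (-1 : ℂ) (t := {s : ℂ | s.re < -1/2})
    (Or.inr (by simp; norm_num)) (by simp; norm_num) u2 hM
  convert u3 using 1
  ext s
  simp only [Om, Set.mem_ofPred_eq, Set.mem_union, ne_iff_lt_or_gt]
  tauto

theorem not_Om {s : ℂ} (h : s ∉ Om) : ∃ x : ℝ, -2 ≤ x ∧ x ≤ 2 ∧ TT s = x ∧ s⁻¹.im ≠ 0 := by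
  simp only [Om, Set.mem_ofPred_eq, not_or, not_lt, ne_eq, not_not] at h
  obtain ⟨h1, h2, h3⟩ := h
  refine ⟨1 + 6 * s.re, by linarith, by linarith, ?_, ?_⟩
  · apply Complex.ext
    · simp [TT, Complex.inv_re, h1]; ring
    · simp [TT, Complex.inv_im, h1]; ring
  · rw [Complex.inv_im, h1]
    rw [Complex.normSq_apply] at h1
    intro h0
    have : s.im = 0 := by linarith
    rw [this] at h1
    nlinarith

theorem Om_T {s : ℂ} (h0 : s ≠ 0) (hs : s ∈ Om) (x : ℝ) (h1 : -2 ≤ x) (h2 : x ≤ 2) : TT s ≠ x := by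
  intro h
  have hn : Complex.normSq s ≠ 0 := by simpa using h0
  have him := congrArg Complex.im h
  have hre := congrArg Complex.re h
  simp [TT, Complex.inv_im] at him
  simp [TT, Complex.inv_re] at hre
  have : s.im * (3 * Complex.normSq s - 1) = 0 := by
    field_simp at him; linear_combination him
  rcases mul_eq_zero.1 this with h | h
  · have hr : Complex.normSq s = s.re^2 := by rw [Complex.normSq_apply, h]; ring
    rw [hr] at hre hn
    have hr0 : s.re ≠ 0 := by intro h; rw [h] at hn; simp at hn
    field_simp at hre
    have hy : (x - 1)^2 ≤ 9 := by nlinarith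
    have e : 3 * s.re^2 + (1 - x) * s.re + 1 = 0 := by linear_combination hre
    nlinarith [sq_nonneg (6 * s.re + (1 - x))]
  · have hr : Complex.normSq s = 1/3 := by linarith
    rw [hr] at hre
    rcases hs with h | h | h
    · exact h hr
    · linarith
    · linarith

/-- sqrt -/
noncomputable def wF (s : ℂ) : ℂ := (1 - 4 / (TT s)^2) ^ (1/2 : ℂ)
/-- the multiplier -/
noncomputable def qF (s : ℂ) : ℂ := (2 / TT s) / (1 + wF s)
/-- fixed point -/
noncomputable def cF (s : ℂ) : ℂ := 1 / (TT s - 2)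
/-- first coefficient -/
noncomputable def aF (s : ℂ) : ℂ := (s⁻¹ - cF s - qF s * (1 - cF s)) / ((qF s)⁻¹ - qF s)
/-- second coefficient -/
noncomputable def bF (s : ℂ) : ℂ := 1 - cF s - aF s

/-- slit plane -/
theorem Om_slit {s : ℂ} (h0 : s ≠ 0) (hs : s ∈ Om) : 1 - 4 / (TT s)^2 ∈ Complex.slitPlane := by
  have hT : TT s ≠ 0 := by simpa using Om_T h0 hs 0 (by norm_num) (by norm_num)
  rw [Complex.mem_slitPlane_iff_not_le_zero]
  intro h
  rw [Complex.le_def] at h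
  obtain ⟨h1, h2⟩ := h
  set z := 1 - 4 / (TT s)^2 with hz
  have hz' : z = (z.re : ℂ) := by apply Complex.ext <;> simp [h2]
  simp at h1
  have hr : (0:ℝ) < 1 - z.re := by linarith
  have hT2 : (TT s)^2 = ((4 / (1 - z.re) : ℝ) : ℂ) := by
    have h4 : 4 / (TT s)^2 = ((1 - z.re : ℝ) : ℂ) := by push_cast; rw [← hz', hz]; ring
    have : ((1 - z.re : ℝ) : ℂ) ≠ 0 := by exact_mod_cast hr.ne'
    rw [Complex.ofReal_div, ← h4]
    field_simp
    norm_num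
  set y := Real.sqrt (4 / (1 - z.re)) with hy
  have hy2 : y^2 = 4 / (1 - z.re) := Real.sq_sqrt (by positivity)
  have hyle : y ≤ 2 := by
    rw [hy, Real.sqrt_le_left (by norm_num), div_le_iff₀ hr]; nlinarith
  have hy0 : 0 ≤ y := Real.sqrt_nonneg _
  rw [← hy2] at hT2
  have : (TT s - y) * (TT s + y) = 0 := by push_cast at hT2; linear_combination hT2
  rcases mul_eq_zero.1 this with h | h
  · exact Om_T h0 hs y (by linarith) hyle (by linear_combination h)
  · exact Om_T h0 hs (-y) (by linarith) (by linarith) (by push_cast; linear_combination h)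

theorem Om_facts {s : ℂ} (h0 : s ≠ 0) (hs : s ∈ Om) :
    TT s ≠ 0 ∧ TT s - 2 ≠ 0 ∧ TT s + 2 ≠ 0 ∧ TT s - 1 ≠ 0 ∧ 1 + wF s ≠ 0 ∧ qF s ≠ 0 ∧ ‖qF s‖ < 1 ∧
    qF s + (qF s)⁻¹ = TT s ∧ (qF s)⁻¹ - qF s ≠ 0 ∧ cF s * (TT s - 2) = 1 ∧ aF s + bF s + cF s = 1 ∧
    aF s * (qF s)⁻¹ + bF s * qF s + cF s = s⁻¹ ∧ aF s * bF s * ((TT s)^2 - 4) = 1 + cF s ∧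
    aF s ≠ 0 ∧ bF s ≠ 0 := by
  have hT : TT s ≠ 0 := by simpa using Om_T h0 hs 0 (by norm_num) (by norm_num)
  have hT2 : TT s - 2 ≠ 0 := by
    intro h; exact Om_T h0 hs 2 (by norm_num) (by norm_num) (by push_cast; linear_combination h)
  have hTm : TT s + 2 ≠ 0 := by
    intro h; exact Om_T h0 hs (-2) (by norm_num) (by norm_num) (by push_cast; linear_combination h)
  have hT1 : TT s - 1 ≠ 0 := by
    intro h; exact Om_T h0 hs 1 (by norm_num) (by norm_num) (by push_cast; linear_combination h)
  have hsl := Om_slit h0 hs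
  have hw2 : (wF s)^2 = 1 - 4 / (TT s)^2 := by
    rw [wF, ← Complex.cpow_nat_mul]; norm_num
  have hwre : 0 < (wF s).re := by
    have hne := Complex.slitPlane_ne_zero hsl
    rw [wF, Complex.cpow_def_of_ne_zero hne, Complex.exp_re]
    apply mul_pos (Real.exp_pos _)
    apply Real.cos_pos_of_mem_Ioo
    have h1 := Complex.neg_pi_lt_arg (1 - 4 / (TT s)^2)
    have h2 := Complex.arg_le_pi (1 - 4 / (TT s)^2)
    have h3 := Complex.mem_slitPlane_iff_arg.1 hsl |>.1
    have h4 := lt_of_le_of_ne h2 h3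
    have : (Complex.log (1 - 4 / (TT s)^2) * (1/2)).im = Complex.arg (1 - 4 / (TT s)^2) / 2 := by
      rw [show (1/2 : ℂ) = ((1/2 : ℝ) : ℂ) by norm_num, Complex.im_mul_ofReal, Complex.log_im]; ring
    rw [this]
    constructor <;> linarith
  have h1w : 1 + wF s ≠ 0 := by
    intro h; have := congrArg Complex.re h; simp at this; linarith
  have hq : qF s ≠ 0 := div_ne_zero (div_ne_zero two_ne_zero hT) h1w
  have hq2 : (qF s)^2 * (1 + wF s) = 1 - wF s := by
    have : (1 - wF s) * (1 + wF s) = 4 / (TT s)^2 := by linear_combination -hw2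
    rw [qF]; field_simp; field_simp at this; linear_combination -this
  have hqT : qF s + (qF s)⁻¹ = TT s := by
    have : qF s * (1 + wF s) * TT s = 2 := by rw [qF]; field_simp
    have h3 : (qF s)^2 + 1 = TT s * qF s := by
      apply mul_right_cancel₀ h1w
      linear_combination hq2 - this
    field_simp
    linear_combination h3
  have hqn : ‖qF s‖ < 1 := by
    have hn : ‖qF s‖^2 * ‖1 + wF s‖ = ‖1 - wF s‖ := by rw [← norm_pow, ← norm_mul, hq2]
    have hlt : ‖1 - wF s‖ < ‖1 + wF s‖ := by
      apply lt_of_pow_lt_pow_left₀ 2 (norm_nonneg _)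
      rw [← Complex.normSq_eq_norm_sq, ← Complex.normSq_eq_norm_sq, Complex.normSq_apply, Complex.normSq_apply]
      simp; nlinarith
    by_contra hcon
    push Not at hcon
    have : 1 ≤ ‖qF s‖^2 := one_le_pow₀ hcon
    nlinarith [norm_nonneg (1 + wF s)]
  have hD : (qF s)⁻¹ - qF s ≠ 0 := by
    intro h
    have : (TT s - 2) * (TT s + 2) = 0 := by
      have e : qF s * (qF s)⁻¹ = 1 := mul_inv_cancel₀ hq
      rw [← hqT]; linear_combination ((qF s)⁻¹ - qF s) * h + 4 * e
    rcases mul_eq_zero.1 this with h | h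
    · exact hT2 h
    · exact hTm h
  have hc : cF s * (TT s - 2) = 1 := by rw [cF]; field_simp
  have hsum : aF s + bF s + cF s = 1 := by rw [bF]; ring
  have hsum1 : aF s * (qF s)⁻¹ + bF s * qF s + cF s = s⁻¹ := by
    have : aF s * ((qF s)⁻¹ - qF s) = s⁻¹ - cF s - qF s * (1 - cF s) := by
      rw [aF]; exact div_mul_cancel₀ _ hD
    rw [bF]; linear_combination this
  have hv : (s⁻¹)^2 + s⁻¹ + 3 = TT s * s⁻¹ := by rw [TT]; field_simp
  have hab : aF s * bF s * ((TT s)^2 - 4) = 1 + cF s := by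
    have e : qF s * (qF s)⁻¹ = 1 := mul_inv_cancel₀ hq
    have hTr : TT s = qF s + (qF s)⁻¹ := hqT.symm
    set a := aF s
    set b := bF s
    set c := cF s
    set q := qF s
    set p := (qF s)⁻¹
    set T := TT s
    have k1 : (a + b)^2 + (a * p + b * q)^2 - T * ((a + b) * (a * p + b * q)) = - (a * b * (T^2 - 4)) := by
      rw [hTr]; linear_combination (4 * a * b + (a+b)^2 - (a+b)^2 - (a^2 + b^2 + 2*a*b)+ 0) * e
    have k2 : a + b = 1 - c := by linear_combination hsum
    have k3 : a * p + b * q = s⁻¹ - c := by linear_combination hsum1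
    rw [k2, k3] at k1
    linear_combination k1 - hv + (c - s⁻¹ - 1) * hc
  have hne : 1 + cF s ≠ 0 := by
    have : (1 + cF s) * (TT s - 2) = TT s - 1 := by linear_combination hc
    intro h; rw [h, zero_mul] at this; exact hT1 this.symm
  refine ⟨hT, hT2, hTm, hT1, h1w, hq, hqn, hqT, hD, hc, hsum, hsum1, hab, ?_, ?_⟩
  · intro h; rw [h] at hab; simp at hab; exact hne hab.symm
  · intro h; rw [h] at hab; simp at hab; exact hne hab.symm

theorem analyticAt_TT {s : ℂ} (h0 : s ≠ 0) : AnalyticAt ℂ TT s := by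
  have : AnalyticAt ℂ (fun s : ℂ => s⁻¹) s := analyticAt_id.inv h0
  exact ((this.add analyticAt_const).add (analyticAt_const.mul analyticAt_id))

theorem analyticAt_qF {s : ℂ} (h0 : s ≠ 0) (hs : s ∈ Om) : AnalyticAt ℂ qF s := by
  obtain ⟨hT, hT2, hTm, hT1, h1w, hq, hqn, hqT, hD, hc, hsum, hsum1, hab, ha, hb⟩ := Om_facts h0 hs
  have hTa := analyticAt_TT h0
  have hw : AnalyticAt ℂ wF s := by
    have hz : AnalyticAt ℂ (fun s => 1 - 4 / (TT s)^2) s :=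
      analyticAt_const.sub (analyticAt_const.div (hTa.pow 2) (pow_ne_zero 2 hT))
    exact hz.cpow analyticAt_const (Om_slit h0 hs)
  exact (analyticAt_const.div hTa hT).div (analyticAt_const.add hw) h1w

theorem analyticAt_cF {s : ℂ} (h0 : s ≠ 0) (hs : s ∈ Om) : AnalyticAt ℂ cF s := by
  obtain ⟨hT, hT2, hTm, hT1, h1w, hq, hqn, hqT, hD, hc, hsum, hsum1, hab, ha, hb⟩ := Om_facts h0 hs
  exact analyticAt_const.div ((analyticAt_TT h0).sub analyticAt_const) hT2

theorem analyticAt_aF {s : ℂ} (h0 : s ≠ 0) (hs : s ∈ Om) : AnalyticAt ℂ aF s := by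
  obtain ⟨hT, hT2, hTm, hT1, h1w, hq, hqn, hqT, hD, hc, hsum, hsum1, hab, ha, hb⟩ := Om_facts h0 hs
  have hqa := analyticAt_qF h0 hs
  have hca := analyticAt_cF h0 hs
  have : AnalyticAt ℂ (fun s : ℂ => s⁻¹) s := analyticAt_id.inv h0
  exact ((this.sub hca).sub (hqa.mul (analyticAt_const.sub hca))).div ((hqa.inv hq).sub hqa) hD

theorem analyticAt_bF {s : ℂ} (h0 : s ≠ 0) (hs : s ∈ Om) : AnalyticAt ℂ bF s :=
  (analyticAt_const.sub (analyticAt_cF h0 hs)).sub (analyticAt_aF h0 hs)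

open Filter Topology

/-- the iterates as functions of s -/
noncomputable def UU (n : ℕ) (s : ℂ) : ℂ := seqU s⁻¹ (TT s) n
/-- terms of the alternating series -/
noncomputable def termF (n : ℕ) (s : ℂ) : ℂ := (-1)^n / (UU n s * UU (n+1) s)
/-- the alternating series -/
noncomputable def Ft (s : ℂ) : ℂ := ∑' n, termF n s

theorem UU_closed {s : ℂ} (h0 : s ≠ 0) (hs : s ∈ Om) (n : ℕ) :
    UU n s = aF s * (qF s)⁻¹^n + bF s * (qF s)^n + cF s := by
  obtain ⟨hT, hT2, hTm, hT1, h1w, hq, hqn, hqT, hD, hc, hsum, hsum1, hab, ha, hb⟩ := Om_facts h0 hs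
  exact seqU_closed hq hqT hc hsum hsum1 n

theorem UU_prod {s : ℂ} (h0 : s ≠ 0) (n : ℕ) :
    UU n s * UU (n+2) s = UU (n+1) s ^ 2 + UU (n+1) s + 1 := by
  apply seqU_prod
  rw [TT]; field_simp

theorem UU_succ (n : ℕ) (s : ℂ) : UU (n+2) s = TT s * UU (n+1) s - 1 - UU n s := seqU_succ _ _ _

theorem analyticAt_UU {s : ℂ} (h0 : s ≠ 0) (n : ℕ) : AnalyticAt ℂ (UU n) s := by
  induction n using Nat.strong_induction_on with
  | _ n ih =>
    match n with
    | 0 => exact analyticAt_const.congr (Eventually.of_forall fun x => (seqU_zero _ _).symm)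
    | 1 => exact (analyticAt_id.inv h0).congr (Eventually.of_forall fun x => (seqU_one _ _).symm)
    | n+2 =>
      exact ((((analyticAt_TT h0).mul (ih (n+1) (by omega))).sub analyticAt_const).sub (ih n (by omega))).congr
        (Eventually.of_forall fun x => (UU_succ n x).symm)

theorem analyticAt_termF {s : ℂ} (h0 : s ≠ 0) (n : ℕ) (h1 : UU n s ≠ 0) (h2 : UU (n+1) s ≠ 0) :
    AnalyticAt ℂ (termF n) s :=
  analyticAt_const.div ((analyticAt_UU h0 n).mul (analyticAt_UU h0 (n+1))) (mul_ne_zero h1 h2)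

theorem UU_bound {s0 : ℂ} (h0 : s0 ≠ 0) (hs : s0 ∈ Om) :
    ∃ (K : ℕ) (C ρ : ℝ), 0 ≤ C ∧ 0 < ρ ∧ ρ < 1 ∧ ∀ᶠ s in 𝓝 s0, s ≠ 0 ∧ s ∈ Om ∧ ∀ n ≥ K, UU n s ≠ 0 ∧
      ‖UU n s‖⁻¹ ≤ C * ρ^n := by
  obtain ⟨hT, hT2, hTm, hT1, h1w, hq, hqn, hqT, hD, hc, hsum, hsum1, hab, ha, hb⟩ := Om_facts h0 hs
  have e1 : ∀ᶠ s in 𝓝 s0, s ≠ 0 := isOpen_ne.mem_nhds h0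
  have e2 : ∀ᶠ s in 𝓝 s0, s ∈ Om := Om_isOpen.mem_nhds hs
  set ρ := (1 + ‖qF s0‖)/2 with hρ
  have hρ0 : 0 < ρ := by positivity
  have hρ1 : ρ < 1 := by linarith
  have e3 : ∀ᶠ s in 𝓝 s0, ‖qF s‖ < ρ :=
    (analyticAt_qF h0 hs).continuousAt.norm.eventually_lt_const (by linarith)
  have hα : 0 < ‖aF s0‖ / 2 := by have := norm_pos_iff.2 ha; positivity
  set α := ‖aF s0‖ / 2
  have e4 : ∀ᶠ s in 𝓝 s0, α < ‖aF s‖ :=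
    (analyticAt_aF h0 hs).continuousAt.norm.eventually_const_lt (by simp only [α] at *; linarith)
  have e5 : ∀ᶠ s in 𝓝 s0, ‖bF s‖ < ‖bF s0‖ + 1 :=
    (analyticAt_bF h0 hs).continuousAt.norm.eventually_lt_const (by linarith)
  have e6 : ∀ᶠ s in 𝓝 s0, ‖cF s‖ < ‖cF s0‖ + 1 :=
    (analyticAt_cF h0 hs).continuousAt.norm.eventually_lt_const (by linarith)
  set B := (‖bF s0‖ + 1) + (‖cF s0‖ + 1) with hB
  have hBp : 0 < B := by positivity
  obtain ⟨K, hK⟩ := exists_pow_lt_of_lt_one (show 0 < α / (2 * B) by positivity) hρ1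
  refine ⟨K, 2/α, ρ, by positivity, hρ0, hρ1, ?_⟩
  filter_upwards [e1, e2, e3, e4, e5, e6] with s e1 e2 e3 e4 e5 e6
  refine ⟨e1, e2, fun n hn => ?_⟩
  obtain ⟨-, -, -, -, -, hq, hqn, -⟩ := Om_facts e1 e2
  have hpn : ρ^n ≤ α / (2*B) := (pow_le_pow_of_le_one hρ0.le hρ1.le hn).trans hK.le
  have hρn : 0 < ρ^n := by positivity
  have key : α / 2 / ρ^n ≤ ‖UU n s‖ := by
    have k1 : ‖aF s * (qF s)⁻¹^n‖ ≤ ‖UU n s‖ + (‖bF s‖ + ‖cF s‖) := by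
      have : aF s * (qF s)⁻¹^n = UU n s - (bF s * (qF s)^n + cF s) := by rw [UU_closed e1 e2]; ring
      rw [this]
      refine (norm_sub_le _ _).trans ?_
      gcongr
      refine (norm_add_le _ _).trans ?_
      gcongr
      rw [norm_mul, norm_pow]
      exact mul_le_of_le_one_right (norm_nonneg _) (pow_le_one₀ (norm_nonneg _) hqn.le)
    have k2 : α / ρ^n ≤ ‖aF s * (qF s)⁻¹^n‖ := by
      rw [norm_mul, norm_pow, norm_inv, inv_pow, ← div_eq_mul_inv]
      have : 0 < ‖qF s‖ := norm_pos_iff.2 hq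
      gcongr
    have k3 : B ≤ α / 2 / ρ^n := by
      rw [le_div_iff₀ hρn]; rw [le_div_iff₀ (by positivity)] at hpn; linarith
    have : α / ρ^n = α/2/ρ^n + α/2/ρ^n := by ring
    linarith
  have hpos : 0 < α / 2 / ρ^n := by positivity
  constructor
  · intro h; rw [h, norm_zero] at key; linarith
  · calc ‖UU n s‖⁻¹ ≤ (α / 2 / ρ^n)⁻¹ := by gcongr
      _ = 2 / α * ρ^n := by field_simp

theorem F_decomp {s0 : ℂ} (h0 : s0 ≠ 0) (hs : s0 ∈ Om) (S : Finset ℕ)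
    (hS : ∀ i ∉ S, UU i s0 ≠ 0 ∧ UU (i+1) s0 ≠ 0) :
    ∃ g : ℂ → ℂ, AnalyticAt ℂ g s0 ∧ ∀ᶠ s in 𝓝 s0, Ft s = ∑ i ∈ S, termF i s + g s := by
  obtain ⟨K, C, ρ, hC, hρ0, hρ1, hev⟩ := UU_bound h0 hs
  obtain ⟨U, hU, hUo, hsU⟩ := eventually_nhds_iff.1 hev
  have hbd : ∀ i, ∀ s ∈ U, ‖termF (i+K) s‖ ≤ C * C * ρ^i := by
    intro i s hsu
    obtain ⟨-, -, h⟩ := hU s hsu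
    have h1 := (h (i+K) (by omega)).2
    have h2 := (h (i+K+1) (by omega)).2
    rw [termF, norm_div, norm_pow, norm_neg, norm_one, one_pow, norm_mul, one_div, mul_inv]
    have h3 : C * ρ^(i+K) ≤ C * ρ^i :=
      mul_le_mul_of_nonneg_left (pow_le_pow_of_le_one hρ0.le hρ1.le (by omega)) hC
    have h4 : C * ρ^(i+K+1) ≤ C := mul_le_of_le_one_right hC (pow_le_one₀ hρ0.le hρ1.le)
    calc _ ≤ (C * ρ^i) * C := by
          apply mul_le_mul (h1.trans h3) (h2.trans h4) (by positivity) (by positivity)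
      _ = _ := by ring
  have hsm : Summable (fun i : ℕ => C * C * ρ^i) :=
    (summable_geometric_of_lt_one hρ0.le hρ1).mul_left _
  have hda : ∀ i ≥ K, ∀ s ∈ U, AnalyticAt ℂ (termF i) s := by
    intro i hi s hsu
    obtain ⟨h1, -, h⟩ := hU s hsu
    exact analyticAt_termF h1 _ (h i hi).1 (h (i+1) (by omega)).1
  have htail : AnalyticAt ℂ (fun s => ∑' i, termF (i+K) s) s0 := by
    have hd : DifferentiableOn ℂ (fun s => ∑' i, termF (i+K) s) U := by
      apply Complex.differentiableOn_tsum_of_summable_norm hsm _ hUo hbd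
      intro i s hsu
      exact (hda _ (by omega) s hsu).differentiableAt.differentiableWithinAt
    exact hd.analyticAt (hUo.mem_nhds hsU)
  refine ⟨fun s => ∑' i, termF (i+K) s + ∑ i ∈ Finset.range K \ S, termF i s
      - ∑ i ∈ S \ Finset.range K, termF i s, ?_, ?_⟩
  · refine (htail.add ?_).sub ?_
    · apply Finset.analyticAt_fun_sum
      intro i hi
      obtain ⟨h1, h2⟩ := hS i (Finset.mem_sdiff.1 hi).2
      exact analyticAt_termF h0 _ h1 h2
    · apply Finset.analyticAt_fun_sum
      intro i hi
      exact hda i (by simpa using (Finset.mem_sdiff.1 hi).2) s0 hsU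
  · filter_upwards [hUo.mem_nhds hsU] with s hsu
    have hsum : Summable (fun i => termF (i+K) s) :=
      Summable.of_norm_bounded hsm (fun i => hbd i s hsu)
    have hsum' : Summable (fun i => termF i s) := (summable_nat_add_iff K).1 hsum
    have e := hsum'.sum_add_tsum_nat_add K
    have e1 := Finset.sum_inter_add_sum_sdiff (Finset.range K) S (fun i => termF i s)
    have e2 := Finset.sum_inter_add_sum_sdiff S (Finset.range K) (fun i => termF i s)
    rw [Finset.inter_comm] at e2
    rw [Ft]
    linear_combination -e - e1 + e2

/-- two vanishing indices determine a = b q^(n+m) -/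
theorem two_zeros {s : ℂ} (h0 : s ≠ 0) (hs : s ∈ Om) {n m : ℕ} (hnm : n < m)
    (hn : UU n s = 0) (hm : UU m s = 0) : aF s = bF s * (qF s)^(n+m) := by
  obtain ⟨hT, hT2, hTm, hT1, h1w, hq, hqn, hqT, hD, hc, hsum, hsum1, hab, ha, hb⟩ := Om_facts h0 hs
  rw [UU_closed h0 hs] at hn hm
  obtain ⟨k, rfl⟩ := Nat.exists_eq_add_of_lt hnm
  set q := qF s
  have hk : 1 - q^(k+1) ≠ 0 := by
    intro h
    have : ‖q^(k+1)‖ < 1 := by rw [norm_pow]; exact pow_lt_one₀ (norm_nonneg _) hqn (by omega)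
    rw [show q^(k+1) = 1 by linear_combination -h] at this
    simp at this
  have e : (aF s - bF s * q^(n+(n+k+1))) * (1 - q^(k+1)) = 0 := by
    have e1 : q⁻¹^n * q^n = 1 := by rw [← mul_pow, inv_mul_cancel₀ hq, one_pow]
    have e2 : q⁻¹^(k+1) * q^(k+1) = 1 := by rw [← mul_pow, inv_mul_cancel₀ hq, one_pow]
    have e3 : q⁻¹^(n+k+1) * q^(n+k+1) = 1 := by rw [← mul_pow, inv_mul_cancel₀ hq, one_pow]
    have : (q^n * q^(k+1)) * ((aF s * q⁻¹^(n+k+1) + bF s * q^(n+k+1) + cF s) - (aF s * q⁻¹^n + bF s * q^n + cF s)) = 0 := by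
      rw [hn, hm]; ring
    have h3 : q^n * q^(k+1) = q^(n+k+1) := by ring
    have h4 : q^(n+(n+k+1)) = q^n * (q^n * q^(k+1)) := by ring
    rw [h3] at this
    have h5 : q^(n+k+1) * q⁻¹^n = q^(k+1) := by
      rw [← h3]; linear_combination q^(k+1) * e1
    rw [h4]
    linear_combination this - aF s * e3 + aF s * h5 - (bF s * q^n - bF s * q^(n+k+1)) * h3
  rcases mul_eq_zero.1 e with h | h
  · linear_combination h
  · exact absurd h hk

theorem pow_inj {q : ℂ} (hq : q ≠ 0) (hqn : ‖q‖ < 1) {n m : ℕ} (h : q^n = q^m) : n = m := by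
  have : ‖q‖^n = ‖q‖^m := by rw [← norm_pow, ← norm_pow, h]
  exact (pow_right_injective₀ (norm_pos_iff.2 hq) hqn.ne) this

theorem zeros_le_two {s : ℂ} (h0 : s ≠ 0) (hs : s ∈ Om) {n m l : ℕ} (hnm : n < m) (hln : l ≠ n) (hlm : l ≠ m)
    (hn : UU n s = 0) (hm : UU m s = 0) : UU l s ≠ 0 := by
  intro hl
  obtain ⟨hT, hT2, hTm, hT1, h1w, hq, hqn, hqT, hD, hc, hsum, hsum1, hab, ha, hb⟩ := Om_facts h0 hs
  have e1 := two_zeros h0 hs hnm hn hm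
  have hd : ∀ {i j : ℕ}, i ≠ j → UU i s = 0 → UU j s = 0 → i + j = n + m := by
    intro i j hij hi hj
    have : aF s = bF s * (qF s)^(i+j) := by
      rcases lt_or_gt_of_ne hij with h | h
      · exact two_zeros h0 hs h hi hj
      · rw [add_comm]; exact two_zeros h0 hs h hj hi
    rw [e1] at this
    exact (pow_inj hq hqn (mul_left_cancel₀ hb this)).symm
  have := hd hln hl hn
  have := hd hlm hl hm
  omega

theorem finite_zeros {s : ℂ} (h0 : s ≠ 0) (hs : s ∈ Om) : ∃ K, ∀ n ≥ K, UU n s ≠ 0 := by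
  obtain ⟨K, C, ρ, -, -, -, hev⟩ := UU_bound h0 hs
  exact ⟨K, fun n hn => (hev.self_of_nhds.2.2 n hn).1⟩

theorem meromorphicAt_Ft {s0 : ℂ} (h0 : s0 ≠ 0) (hs : s0 ∈ Om) : MeromorphicAt Ft s0 := by
  obtain ⟨K, hK⟩ := finite_zeros h0 hs
  obtain ⟨g, hg, hev⟩ := F_decomp h0 hs (Finset.range K) (by
    intro i hi
    have : K ≤ i := by simpa using hi
    exact ⟨hK _ this, hK _ (by omega)⟩)
  have : MeromorphicAt (fun s => ∑ i ∈ Finset.range K, termF i s + g s) s0 := by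
    refine MeromorphicAt.fun_add (MeromorphicAt.fun_sum fun i _ => ?_) hg.meromorphicAt
    exact (MeromorphicAt.const _ _).div
      ((analyticAt_UU h0 i).meromorphicAt.mul (analyticAt_UU h0 (i+1)).meromorphicAt)
  exact this.congr (by
    filter_upwards [hev.filter_mono nhdsWithin_le_nhds] with s h
    exact h.symm)

open Filter Topology

theorem ev_ne {s0 : ℂ} (h0 : s0 ≠ 0) : ∀ᶠ s in 𝓝 s0, s ≠ 0 := isOpen_ne.mem_nhds h0

theorem hasDerivAt_unique_of_eventuallyEq {f g : ℂ → ℂ} {f' g' x : ℂ} (h : f =ᶠ[𝓝 x] g)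
    (hf : HasDerivAt f f' x) (hg : HasDerivAt g g' x) : f' = g' :=
  hf.unique (hg.congr_of_eventuallyEq h)

theorem hasDerivAt_pow_log {f : ℂ → ℂ} {h x : ℂ} (hf : HasDerivAt f (f x * h) x) (n : ℕ) :
    HasDerivAt (fun s => f s ^ n) (n * h * f x ^ n) x := by
  induction n with
  | zero => simpa using hasDerivAt_const x (1:ℂ)
  | succ n ih =>
    have := ih.mul hf
    refine (this.congr_deriv ?_).congr_of_eventuallyEq (Eventually.of_forall fun s => ?_)
    · push_cast; ring
    · simp [pow_succ]

theorem deriv_facts {s0 : ℂ} (h0 : s0 ≠ 0) (hs : s0 ∈ Om) :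
    ∃ α β c' h D : ℂ, D = qF s0 - (qF s0)⁻¹ ∧ D^2 = (TT s0)^2 - 4 ∧ HasDerivAt TT (D * h) s0 ∧
    c' * (TT s0 - 2) + cF s0 * (D * h) = 0 ∧
    aF s0 * α + bF s0 * β + c' = 0 ∧
    (α + β) * (aF s0 * bF s0) * (TT s0^2 - 4) + aF s0 * bF s0 * (2 * TT s0 * (D * h)) = c' ∧
    ∀ n, HasDerivAt (UU n) (α * (aF s0 * (qF s0)⁻¹^n) + β * (bF s0 * (qF s0)^n) + c'
      + n * h * (bF s0 * (qF s0)^n - aF s0 * (qF s0)⁻¹^n)) s0 := by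
  obtain ⟨hT, hT2, hTm, hT1, h1w, hq, hqn, hqT, hD, hc, hsum, hsum1, hab, ha, hb⟩ := Om_facts h0 hs
  have da := (analyticAt_aF h0 hs).differentiableAt.hasDerivAt
  have db := (analyticAt_bF h0 hs).differentiableAt.hasDerivAt
  have dc := (analyticAt_cF h0 hs).differentiableAt.hasDerivAt
  have dq := (analyticAt_qF h0 hs).differentiableAt.hasDerivAt
  have ev : ∀ᶠ s in 𝓝 s0, s ≠ 0 ∧ s ∈ Om :=
    (ev_ne h0).and (Om_isOpen.mem_nhds hs)
  set a' := deriv aF s0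
  set b' := deriv bF s0
  set c' := deriv cF s0
  set q' := deriv qF s0
  have dq' : HasDerivAt qF (qF s0 * (q' / qF s0)) s0 :=
    dq.congr_deriv (mul_div_cancel₀ _ hq).symm
  have dqi : HasDerivAt (fun s => (qF s)⁻¹) ((qF s0)⁻¹ * (-(q' / qF s0))) s0 :=
    (dq.inv hq).congr_deriv (by ring)
  have dT : HasDerivAt TT ((qF s0 - (qF s0)⁻¹) * (q' / qF s0)) s0 := by
    have := dq'.add dqi
    refine (this.congr_deriv (by ring)).congr_of_eventuallyEq ?_
    filter_upwards [ev] with s ⟨e1, e2⟩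
    obtain ⟨-, -, -, -, -, -, -, hqT, -⟩ := Om_facts e1 e2
    exact hqT.symm
  refine ⟨a' / aF s0, b' / bF s0, c', q' / qF s0, qF s0 - (qF s0)⁻¹, rfl, ?_, dT, ?_, ?_, ?_, ?_⟩
  · rw [← hqT]; field_simp; ring
  · refine hasDerivAt_unique_of_eventuallyEq (f := fun s => cF s * (TT s - 2)) (g := fun _ => 1) ?_
      ((dc.mul (dT.sub_const 2)).congr_deriv (by ring)) (hasDerivAt_const _ _)
    filter_upwards [ev] with s ⟨e1, e2⟩
    obtain ⟨-, -, -, -, -, -, -, -, -, hc, -⟩ := Om_facts e1 e2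
    exact hc
  · refine hasDerivAt_unique_of_eventuallyEq (f := fun s => aF s + bF s + cF s) (g := fun _ => 1) ?_
      (((da.add db).add dc).congr_deriv (by field_simp)) (hasDerivAt_const _ _)
    filter_upwards [ev] with s ⟨e1, e2⟩
    obtain ⟨-, -, -, -, -, -, -, -, -, -, hc, -⟩ := Om_facts e1 e2
    exact hc
  · refine hasDerivAt_unique_of_eventuallyEq (f := fun s => aF s * bF s * (TT s ^2 - 4)) (g := fun s => 1 + cF s) ?_
      (((da.mul db).mul ((hasDerivAt_pow_log (h := ((qF s0 - (qF s0)⁻¹) * (q' / qF s0)) / TT s0)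
        (dT.congr_deriv (by field_simp)) 2).sub_const 4)).congr_deriv ?_) (dc.const_add 1)
    · filter_upwards [ev] with s ⟨e1, e2⟩
      obtain ⟨-, -, -, -, -, -, -, -, -, -, -, -, hab, -⟩ := Om_facts e1 e2
      exact hab
    · simp only [Pi.mul_apply]
      generalize (qF s0 - (qF s0)⁻¹) * (q' / qF s0) = z
      push_cast
      field_simp
  · intro n
    have := ((da.mul (hasDerivAt_pow_log dqi n)).add (db.mul (hasDerivAt_pow_log dq' n))).add dc
    refine (this.congr_deriv ?_).congr_of_eventuallyEq ?_
    · generalize (qF s0)⁻¹^n = X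
      generalize (qF s0)^n = Y
      generalize q' / qF s0 = z
      field_simp
      ring
    · filter_upwards [ev] with s ⟨e1, e2⟩
      rw [UU_closed e1 e2]; rfl

theorem seqU_real (v T : ℝ) (n : ℕ) : ((seqU v T n : ℝ) : ℂ) = seqU (v:ℂ) (T:ℂ) n := by
  induction n using Nat.strong_induction_on with
  | _ n ih =>
    match n with
    | 0 => simp [seqU_zero]
    | 1 => simp [seqU_one]
    | n+2 => rw [seqU_succ, seqU_succ]; push_cast; rw [ih n (by omega), ih (n+1) (by omega)]

theorem kappa_next {s : ℂ} (h0 : s ≠ 0) (n : ℕ) (hn : UU n s = 0) : UU (n+1) s ^2 + UU (n+1) s + 1 = 0 := by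
  have := seqU_inv s⁻¹ (TT s) (by rw [TT]; field_simp) n
  change UU n s ^2 + UU (n+1) s ^2 + UU n s + UU (n+1) s + 1 = TT s * (UU n s * UU (n+1) s) at this
  rw [hn] at this; linear_combination this

theorem kappa_prev {s : ℂ} (h0 : s ≠ 0) (n : ℕ) (hn : UU (n+1) s = 0) : UU n s ^2 + UU n s + 1 = 0 := by
  have := seqU_inv s⁻¹ (TT s) (by rw [TT]; field_simp) n
  change UU n s ^2 + UU (n+1) s ^2 + UU n s + UU (n+1) s + 1 = TT s * (UU n s * UU (n+1) s) at this
  rw [hn] at this; linear_combination this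

theorem s0_not_real {s : ℂ} (h0 : s ≠ 0) {n : ℕ} (hn : UU n s = 0) : s^2 ≠ 1/3 := by
  intro h
  have hs : ∃ r : ℝ, s = r := by
    have h3 : (0:ℝ) ≤ 1/3 := by norm_num
    have e : ((Real.sqrt (1/3) : ℝ) : ℂ)^2 = 1/3 := by
      rw [← Complex.ofReal_pow, Real.sq_sqrt h3]; norm_num
    rw [← e] at h
    rcases sq_eq_sq_iff_eq_or_eq_neg.1 h with h | h
    · exact ⟨_, h⟩
    · exact ⟨-Real.sqrt (1/3), by rw [h]; push_cast; ring⟩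
  obtain ⟨r, rfl⟩ := hs
  have hk := kappa_next h0 n hn
  have : UU (n+1) (r:ℂ) = ((seqU r⁻¹ (r⁻¹ + 1 + 3 * r) (n+1) : ℝ) : ℂ) := by
    rw [seqU_real]; push_cast; rfl
  rw [this] at hk
  set z := seqU r⁻¹ (r⁻¹ + 1 + 3 * r) (n+1)
  have hk' : z^2 + z + 1 = 0 := by exact_mod_cast hk
  nlinarith [sq_nonneg (2 * z + 1)]

theorem UU_eventually_ne {s0 : ℂ} (h0 : s0 ≠ 0) (n : ℕ) : ∀ᶠ s in 𝓝[≠] s0, UU n s ≠ 0 := by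
  have hfin : {s : ℂ | s ∈ (polU n).roots.toFinset}.Finite := (polU n).roots.toFinset.finite_toSet
  have h1 : ∀ᶠ s in 𝓝[≠] s0, s ∉ {s : ℂ | s ∈ (polU n).roots.toFinset} := by
    have := (hfin.subset (Set.sdiff_subset (t := {s0}))).isClosed.isOpen_compl.mem_nhds
      (show s0 ∈ ({s : ℂ | s ∈ (polU n).roots.toFinset} \ {s0})ᶜ by simp)
    rw [eventually_nhdsWithin_iff]
    filter_upwards [this] with s hs hne h
    exact hs ⟨h, hne⟩
  filter_upwards [h1, (ev_ne h0).filter_mono nhdsWithin_le_nhds] with s h1 h2 h3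
  apply h1
  simp only [Multiset.mem_toFinset, Polynomial.mem_roots (polU_ne_zero n), Polynomial.IsRoot.def]
  rw [polU_eval h2]
  have : seqU s⁻¹ (s⁻¹ + 1 + 3 * s) n = 0 := h3
  rw [this, mul_zero]

/-- the residue numerator -/
noncomputable def eF (p : ℕ) (s : ℂ) : ℂ := UU (p+2) s - UU p s
/-- the denominator -/
noncomputable def dF (p : ℕ) (s : ℂ) : ℂ := UU (p+1) s * (UU (p+1) s ^ 2 + UU (p+1) s + 1)

theorem analyticAt_eF {s : ℂ} (h0 : s ≠ 0) (p : ℕ) : AnalyticAt ℂ (eF p) s :=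
  (analyticAt_UU h0 _).sub (analyticAt_UU h0 _)

theorem analyticAt_dF {s : ℂ} (h0 : s ≠ 0) (p : ℕ) : AnalyticAt ℂ (dF p) s :=
  (analyticAt_UU h0 _).mul ((((analyticAt_UU h0 _).pow 2).add (analyticAt_UU h0 _)).add analyticAt_const)

theorem eF_sq {s : ℂ} (h0 : s ≠ 0) {p : ℕ} (hp : UU (p+1) s = 0) : eF p s ^ 2 = -3 := by
  have h1 := UU_prod h0 p
  have h2 := UU_succ p s
  rw [hp] at h1 h2
  rw [eF]
  linear_combination (-4) * h1 + (UU (p+2) s + UU p s - 1) * h2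

theorem pair_eq {s0 : ℂ} (h0 : s0 ≠ 0) (p : ℕ) :
    ∀ᶠ s in 𝓝[≠] s0, dF p s ≠ 0 ∧ termF p s + termF (p+1) s = (-1)^p * eF p s / dF p s := by
  filter_upwards [UU_eventually_ne h0 p, UU_eventually_ne h0 (p+1), UU_eventually_ne h0 (p+2),
    (ev_ne h0).filter_mono nhdsWithin_le_nhds] with s h1 h2 h3 h4
  have e : dF p s = UU (p+1) s * (UU p s * UU (p+2) s) := by rw [dF, UU_prod h4]
  rw [e]
  refine ⟨mul_ne_zero h2 (mul_ne_zero h1 h3), ?_⟩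
  rw [termF, termF, eF, pow_succ]
  field_simp
  ring

theorem order_nonneg_ext {f : ℂ → ℂ} {x : ℂ} (hf : MeromorphicAt f x) (h : ¬ meromorphicOrderAt f x < 0) :
    ∃ G, AnalyticAt ℂ G x ∧ f =ᶠ[𝓝[≠] x] G := by
  exact (hf.meromorphicOrderAt_nonneg_iff).1 (not_lt.1 h)

theorem Ft_pole_single {s0 : ℂ} (h0 : s0 ≠ 0) (hs : s0 ∈ Om) {p : ℕ} (hp : UU (p+1) s0 = 0)
    (hone : ∀ i, i ≠ p+1 → UU i s0 ≠ 0) : meromorphicOrderAt Ft s0 < 0 := by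
  by_contra hcon
  obtain ⟨G, hG, hFG⟩ := order_nonneg_ext (meromorphicAt_Ft h0 hs) hcon
  obtain ⟨g, hg, hev⟩ := F_decomp h0 hs {p, p+1} (by
    intro i hi
    simp only [Finset.mem_insert, Finset.mem_singleton, not_or] at hi
    exact ⟨hone _ hi.2, hone _ (by omega)⟩)
  have hA : AnalyticAt ℂ (fun s => (G s - g s) * dF p s) s0 := (hG.sub hg).mul (analyticAt_dF h0 p)
  have hB : AnalyticAt ℂ (fun s => (-1)^p * eF p s) s0 := analyticAt_const.mul (analyticAt_eF h0 p)
  have heq : (fun s => (-1)^p * eF p s) =ᶠ[𝓝[≠] s0] (fun s => (G s - g s) * dF p s) := by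
    filter_upwards [hFG, hev.filter_mono nhdsWithin_le_nhds, pair_eq h0 p] with s h1 h2 h3
    rw [Finset.sum_pair (by omega), h3.2] at h2
    rw [← h1, h2]
    have := h3.1
    field_simp
    ring
  have heq' := (hB.continuousAt.eventuallyEq_nhds_iff_eventuallyEq_nhdsNE hA.continuousAt).1 heq
  have := heq'.eq_of_nhds
  simp only [dF, hp] at this
  have e : eF p s0 = 0 := by simpa using this
  have := eF_sq h0 hp
  rw [e] at this
  norm_num at this

theorem odd_num {x y : ℝ} (hx : 2 ≤ x) (hy : 1 ≤ y) (e : 9 = 3 * x^2 * y^2) : False := by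
  have h1 : 4 ≤ x^2 := by nlinarith
  have h2 : 1 ≤ y^2 := by nlinarith
  nlinarith

theorem Ft_pole_double {s0 : ℂ} (h0 : s0 ≠ 0) (hs : s0 ∈ Om) {n m : ℕ} (hnm : n < m)
    (hn : UU n s0 = 0) (hm : UU m s0 = 0) (hN : 500 ≤ n + m) (hτ : 1 ≤ ‖s0⁻¹ + 3 * s0‖) :
    meromorphicOrderAt Ft s0 < 0 := by
  by_contra hcon
  have hother : ∀ l, l ≠ n → l ≠ m → UU l s0 ≠ 0 := fun l h1 h2 => zeros_le_two h0 hs hnm h1 h2 hn hm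
  have hk2 : n + 2 ≤ m := by
    by_contra h
    have : m = n + 1 := by omega
    subst this
    have := kappa_next h0 n hn
    rw [hm] at this; norm_num at this
  have hn0 : n ≠ 0 := by
    rintro rfl
    have : UU 0 s0 = 1 := rfl
    rw [this] at hn; norm_num at hn
  obtain ⟨p, rfl⟩ := Nat.exists_eq_succ_of_ne_zero hn0
  obtain ⟨r, rfl⟩ := Nat.exists_eq_succ_of_ne_zero (show m ≠ 0 by omega)
  simp only [Nat.succ_eq_add_one] at *
  obtain ⟨G, hG, hFG⟩ := order_nonneg_ext (meromorphicAt_Ft h0 hs) hcon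
  have hdis : Disjoint ({p, p+1} : Finset ℕ) {r, r+1} := by
    rw [Finset.disjoint_left]
    intro i hi
    simp only [Finset.mem_insert, Finset.mem_singleton] at hi ⊢
    omega
  obtain ⟨g, hg, hev⟩ := F_decomp h0 hs ({p, p+1} ∪ {r, r+1}) (by
    intro i hi
    simp only [Finset.mem_union, Finset.mem_insert, Finset.mem_singleton, not_or] at hi
    exact ⟨hother _ (by omega) (by omega), hother _ (by omega) (by omega)⟩)
  have hA : AnalyticAt ℂ (fun s => (G s - g s) * (dF p s * dF r s)) s0 :=
    (hG.sub hg).mul ((analyticAt_dF h0 p).mul (analyticAt_dF h0 r))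
  have hB : AnalyticAt ℂ (fun s => (-1)^p * (eF p s * dF r s) + (-1)^r * (eF r s * dF p s)) s0 :=
    (analyticAt_const.mul ((analyticAt_eF h0 p).mul (analyticAt_dF h0 r))).add
      (analyticAt_const.mul ((analyticAt_eF h0 r).mul (analyticAt_dF h0 p)))
  have heq : (fun s => (-1)^p * (eF p s * dF r s) + (-1)^r * (eF r s * dF p s))
      =ᶠ[𝓝[≠] s0] (fun s => (G s - g s) * (dF p s * dF r s)) := by
    filter_upwards [hFG, hev.filter_mono nhdsWithin_le_nhds, pair_eq h0 p, pair_eq h0 r] with s h1 h2 h3 h4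
    rw [Finset.sum_union hdis, Finset.sum_pair (by omega), Finset.sum_pair (by omega), h3.2, h4.2] at h2
    rw [← h1, h2]
    have := h3.1
    have := h4.1
    field_simp
    ring
  have heq' := (hB.continuousAt.eventuallyEq_nhds_iff_eventuallyEq_nhdsNE hA.continuousAt).1 heq
  obtain ⟨hT, hT2, hTm, hT1, h1w, hq, hqn, hqT, hDn, hc, hsum, hsum1, hab, ha, hb⟩ := Om_facts h0 hs
  obtain ⟨α, β, c', h, D, hDd, hD2, hdT, hc', hsum', hK, hdU⟩ := deriv_facts h0 hs
  set q := qF s0 with hqdef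
  set a := aF s0
  set b := bF s0
  set c := cF s0
  set T := TT s0 with hTdef
  -- derivative of the denominators
  have dd : ∀ {j : ℕ} {u' : ℂ}, UU (j+1) s0 = 0 → HasDerivAt (UU (j+1)) u' s0 → HasDerivAt (dF j) u' s0 := by
    intro j u' hj hd
    have h2 := ((hd.mul hd).add hd).add_const (1:ℂ)
    have := hd.mul h2
    refine (this.congr_deriv ?_).congr_of_eventuallyEq (Eventually.of_forall fun s => ?_)
    · simp [hj]
    · simp [dF, pow_two]
  have dp := dd hn (hdU (p+1))
  have dr := dd hm (hdU (r+1))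
  have d0p : dF p s0 = 0 := by simp [dF, hn]
  have d0r : dF r s0 = 0 := by simp [dF, hm]
  set up := α * (a * q⁻¹^(p+1)) + β * (b * q^(p+1)) + c' + ((p+1 : ℕ):ℂ) * h * (b * q^(p+1) - a * q⁻¹^(p+1)) with hup
  set ur := α * (a * q⁻¹^(r+1)) + β * (b * q^(r+1)) + c' + ((r+1 : ℕ):ℂ) * h * (b * q^(r+1) - a * q⁻¹^(r+1)) with hur
  have ep := (analyticAt_eF h0 p).differentiableAt.hasDerivAt
  have er := (analyticAt_eF h0 r).differentiableAt.hasDerivAt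
  have hlin : (-1)^p * (eF p s0 * ur) + (-1)^r * (eF r s0 * up) = 0 := by
    refine hasDerivAt_unique_of_eventuallyEq heq'
      ((((ep.mul dr).const_mul ((-1)^p)).add ((er.mul dp).const_mul ((-1)^r))).congr_deriv ?_)
      ((((hG.sub hg).differentiableAt.hasDerivAt).mul (dp.mul dr)).congr_deriv ?_)
    · simp [d0p, d0r]
    · simp [d0p, d0r]
  have htz := two_zeros h0 hs hnm hn hm
  change a = b * q^(p+1+(r+1)) at htz
  have qq : ∀ j, q⁻¹^j * q^j = 1 := fun j => by rw [← mul_pow, inv_mul_cancel₀ hq, one_pow]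
  have hy : a * q⁻¹^(p+1) = b * q^(r+1) := by
    rw [htz, pow_add]; linear_combination b * q^(r+1) * qq (p+1)
  have hx : a * q⁻¹^(r+1) = b * q^(p+1) := by
    rw [htz, pow_add]; linear_combination b * q^(p+1) * qq (r+1)
  have hepv : eF p s0 = -D * (b * q^(r+1) - b * q^(p+1)) := by
    rw [← hy, eF, UU_closed h0 hs, UU_closed h0 hs, hDd]
    change a * q⁻¹^(p+2) + b * q^(p+2) + c - (a * q⁻¹^p + b * q^p + c) = _
    have e : q * q⁻¹ = 1 := mul_inv_cancel₀ hq
    simp only [pow_succ]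
    linear_combination (a * q⁻¹^p + b * q^p) * e
  have herv : eF r s0 = -D * (b * q^(p+1) - b * q^(r+1)) := by
    rw [← hx, eF, UU_closed h0 hs, UU_closed h0 hs, hDd]
    change a * q⁻¹^(r+2) + b * q^(r+2) + c - (a * q⁻¹^r + b * q^r + c) = _
    have e : q * q⁻¹ = 1 := mul_inv_cancel₀ hq
    simp only [pow_succ]
    linear_combination (a * q⁻¹^r + b * q^r) * e
  have hepsq := eF_sq h0 hn
  have hepn : eF p s0 ≠ 0 := by intro h; rw [h] at hepsq; norm_num at hepsq
  have herp : eF r s0 = - eF p s0 := by rw [hepv, herv]; ring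
  rw [herp] at hlin
  have hrel : (-1)^p * ur = (-1)^r * up := by
    apply mul_left_cancel₀ hepn; linear_combination hlin
  rw [hy] at hup
  rw [hx] at hur
  set x := b * q^(p+1) with hxd
  set y := b * q^(r+1) with hyd
  have hyx : y - x ≠ 0 := by
    intro h; rw [h] at hepv; simp at hepv; exact hepn hepv
  have hxyc : x + y = -c := by
    have := hn
    rw [UU_closed h0 hs] at this
    change a * q⁻¹^(p+1) + b * q^(p+1) + c = 0 at this
    rw [hy] at this; linear_combination this
  have hxyab : x * y = a * b := by
    rw [← hy, hxd]; linear_combination a * b * qq (p+1)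
  have hh : h ≠ 0 := by
    rintro rfl
    have h1 : HasDerivAt TT (-(s0^2)⁻¹ + 3) s0 := by
      have := ((hasDerivAt_inv h0).add_const (1:ℂ)).add ((hasDerivAt_id s0).const_mul 3)
      exact this.congr_deriv (by simp)
    have h2 := hdT.unique h1
    apply s0_not_real h0 hn
    have h3 : s0^2 ≠ 0 := pow_ne_zero 2 h0
    have : (s0^2)⁻¹ = 3 := by linear_combination h2
    rw [← inv_inv (s0^2), this]; norm_num
  set τ := s0⁻¹ + 3 * s0 with hτd
  have hTτ : T = τ + 1 := by rw [hTdef, TT, hτd]; ring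
  have hτ0 : τ ≠ 0 := by
    intro h; rw [h, norm_zero] at hτ; linarith
  have hcv : c = 1 / (τ - 1) := by
    rw [hTτ] at hc
    have : τ - 1 ≠ 0 := by intro h0; apply hT2; rw [hTτ]; linear_combination h0
    field_simp
    linear_combination hc
  obtain ⟨k, hk⟩ : ∃ k, r = p + k := ⟨r - p, by omega⟩
  have hkk : 2 ≤ k := by omega
  rcases Nat.even_or_odd k with hev | hodd
  · -- even
    have hs1 : ((-1:ℂ))^r = (-1)^p := by rw [hk, pow_add, hev.neg_one_pow, mul_one]
    rw [hs1] at hrel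
    have hrel' : ur = up := mul_left_cancel₀ (pow_ne_zero _ (by norm_num)) hrel
    have hev' := cancel_even (N := ((p+1+(r+1) : ℕ) : ℂ)) (x := x) (y := y) hh hD2 hT2 hTm hT1 hc hsum hab hc' hsum' hK hyx (by
      rw [hup, hur] at hrel'
      push_cast at hrel' ⊢
      linear_combination -hrel')
    have hcn : c ≠ 0 := by intro h0; rw [h0] at hc; simp at hc
    have hDD : T^2 - 4 ≠ 0 := by
      rw [show T^2 - 4 = (T-2)*(T+2) by ring]; exact mul_ne_zero hT2 hTm
    have hab0 : a * b ≠ 0 := mul_ne_zero ha hb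
    have hcc : (1 + c) = (T-1) * c := by linear_combination -hc
    have hck : q^k + q⁻¹^k = 3 / τ - 1 := by
      have e1 : y = x * q^k := by rw [hyd, hxd, hk]; ring
      have e2 : (q^k + q⁻¹^k + 2) * (x * y) = (x + y)^2 := by
        rw [e1]; linear_combination (x^2) * qq k
      rw [hxyab, hxyc] at e2
      have e3 : (q^k + q⁻¹^k + 2) * (τ) = τ + 3 := by
        apply mul_right_cancel₀ hcn
        have hT3 : T - 1 = τ := by rw [hTτ]; ring
        have h5 : c * (T^2 - 4) = T + 2 := by linear_combination (T+2) * hc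
        have h6 : (q^k + q⁻¹^k + 2) * (τ * c) = c * (T + 2) := by
          rw [← hT3, ← hcc, ← hab, ← h5]
          linear_combination (T^2-4) * e2
        rw [hTτ] at h6
        linear_combination h6
      field_simp
      linear_combination e3
    have hcN : q^(p+1+(r+1)) + q⁻¹^(p+1+(r+1)) = τ^2 - τ - 10 + 12 / τ := by
      set N := p+1+(r+1)
      have e2 : (q^N + q⁻¹^N + 2) * (a * b) = (a + b)^2 := by
        rw [htz]; linear_combination b^2 * qq N
      have e3 : a + b = 1 - c := by linear_combination hsum
      rw [e3] at e2
      have hT3 : T - 1 = τ := by rw [hTτ]; ring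
      have e4 : (q^N + q⁻¹^N + 2) * τ = (T-3)^2 * (T+2) := by
        apply mul_right_cancel₀ hcn
        have h6 : (q^N + q⁻¹^N + 2) * (τ * c) = (1-c)^2 * (T^2-4) := by
          rw [← hT3, ← hcc, ← hab]
          linear_combination (T^2-4) * e2
        have h7 : (1 - c) = (T-3) * c := by linear_combination -hc
        have h5 : c * (T^2 - 4) = T + 2 := by linear_combination (T+2) * hc
        rw [h7] at h6
        linear_combination h6 + (T-3)^2 * c * h5
      rw [hTτ] at e4
      field_simp
      linear_combination e4
    refine bad_estimate (N := p+1+(r+1)) hq hqn hτ (hqT.trans hTτ) hkk hN hck hcN ?_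
    rw [hTτ] at hev'
    linear_combination hev'
  · have hs1 : ((-1:ℂ))^r = -(-1)^p := by rw [hk, pow_add, hodd.neg_one_pow]; ring
    rw [hs1] at hrel
    have hrel' : ur = -up := by
      apply mul_left_cancel₀ (pow_ne_zero p (show (-1:ℂ) ≠ 0 by norm_num)); linear_combination hrel
    have hod := cancel_odd (k := (k:ℂ)) hh hD2 hT2 hTm hT1 hc hab hc' hK hxyc hxyab (by
      rw [hup, hur, hk] at hrel'
      push_cast at hrel'
      linear_combination hrel')
    have hT3 : T - 1 = τ := by rw [hTτ]; ring
    rw [hT3] at hod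
    have e : (9:ℝ) = 3 * (k:ℝ)^2 * ‖τ‖^2 := by
      have := congrArg norm hod
      simpa using this
    have hk3 : (2:ℝ) ≤ k := by exact_mod_cast hkk
    exact odd_num hk3 hτ e

theorem Ft_pole {s0 : ℂ} (h0 : s0 ≠ 0) (hs : s0 ∈ Om) {n : ℕ} (hn : UU n s0 = 0) (hN : 500 ≤ n)
    (hτ : 1 ≤ ‖s0⁻¹ + 3 * s0‖) : meromorphicOrderAt Ft s0 < 0 := by
  by_cases h : ∃ m, m ≠ n ∧ UU m s0 = 0
  · obtain ⟨m, hmn, hm⟩ := h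
    rcases lt_or_gt_of_ne hmn with h | h
    · exact Ft_pole_double h0 hs h hm hn (by omega) hτ
    · exact Ft_pole_double h0 hs h hn hm (by omega) hτ
  · push Not at h
    obtain ⟨p, rfl⟩ := Nat.exists_eq_succ_of_ne_zero (show n ≠ 0 by omega)
    exact Ft_pole_single h0 hs hn h

open Filter Topology

/-- the step set -/
def stepS : Finset (ℤ × ℤ) := {(-1,1),(0,1),(1,1),(1,0),(1,-1)}

/-- admissible walks -/
def okW (n : ℕ) (f : Fin n → ℤ × ℤ) : Prop :=
  (∀ k, f k ∈ stepS) ∧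
    ∀ k : Fin n, 0 ≤ ∑ j ∈ Finset.Iic k, (f j).1 ∧ 0 ≤ ∑ j ∈ Finset.Iic k, (f j).2

open Classical in
/-- the finset of walks -/
noncomputable def Wk (n : ℕ) : Finset (Fin n → ℤ × ℤ) :=
  (Fintype.piFinset (fun _ : Fin n => stepS)).filter (okW n)

theorem mem_Wk {n : ℕ} {f : Fin n → ℤ × ℤ} : f ∈ Wk n ↔ okW n f := by
  simp only [Wk, Finset.mem_filter, Fintype.mem_piFinset, and_iff_right_iff_imp]
  exact fun h => h.1

theorem quarterPlaneWalks_eq (n : ℕ) :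
    quarterPlaneWalks ({(-1,1),(0,1),(1,1),(1,0),(1,-1)} : Finset (ℤ × ℤ)) n = (Wk n).card := by
  rw [quarterPlaneWalks, ← Nat.card_eq_finsetCard]
  apply Nat.card_congr
  exact Equiv.subtypeEquivRight (fun f => (mem_Wk (f := f)).symm)

theorem Wk_card_le (n : ℕ) : (Wk n).card ≤ 5^n := by
  classical
  refine (Finset.card_filter_le _ _).trans ?_
  rw [Fintype.card_piFinset]
  have : stepS.card = 5 := by decide
  simp [this]

/-- the quadrant -/
def quad (p : ℤ × ℤ) : Prop := 0 ≤ p.1 ∧ 0 ≤ p.2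

instance : DecidablePred quad := fun p => by unfold quad; infer_instance

theorem okW_snoc {n : ℕ} (g : Fin n → ℤ × ℤ) (s : ℤ × ℤ) :
    okW (n+1) (Fin.snoc g s : Fin (n+1) → ℤ × ℤ) ↔ okW n g ∧ s ∈ stepS ∧ quad (∑ j, g j + s) := by
  have h1 : ∀ (k : Fin n) (φ : ℤ × ℤ → ℤ), ∑ j ∈ Finset.Iic k.castSucc, φ ((Fin.snoc g s : Fin (n+1) → ℤ × ℤ) j)
      = ∑ j ∈ Finset.Iic k, φ (g j) := by
    intro k φ
    rw [← Fin.map_castSuccEmb_Iic, Finset.sum_map]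
    simp
  have h2 : ∀ (φ : ℤ × ℤ → ℤ), ∑ j ∈ Finset.Iic (Fin.last n), φ ((Fin.snoc g s : Fin (n+1) → ℤ × ℤ) j)
      = ∑ j, φ (g j) + φ s := by
    intro φ
    have : Finset.Iic (Fin.last n) = Finset.univ := by ext; simp [Fin.le_last]
    rw [this, Fin.sum_univ_castSucc]
    simp
  unfold okW quad
  rw [Fin.forall_fin_succ', Fin.forall_fin_succ']
  rw [h2 Prod.fst, h2 Prod.snd]
  simp only [Fin.snoc_castSucc, Fin.snoc_last, h1 _ Prod.fst, h1 _ Prod.snd, Prod.fst_add, Prod.snd_add,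
    Prod.fst_sum, Prod.snd_sum]
  tauto

theorem Wk_quad {n : ℕ} {f : Fin n → ℤ × ℤ} (hf : f ∈ Wk n) : quad (∑ j, f j) := by
  cases n with
  | zero => simp [quad]
  | succ n =>
    rw [mem_Wk, ← Fin.snoc_init_self f, okW_snoc] at hf
    rw [Fin.sum_univ_castSucc]
    exact hf.2.2

/-- weighted sum over walks -/
noncomputable def EE (n : ℕ) (G : ℤ × ℤ → ℂ) : ℂ := ∑ f ∈ Wk n, G (∑ j, f j)

/-- one step operator -/
noncomputable def stp (G : ℤ × ℤ → ℂ) (p : ℤ × ℤ) : ℂ := ∑ s ∈ stepS, if quad (p + s) then G (p + s) else 0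

theorem EE_zero (G : ℤ × ℤ → ℂ) : EE 0 G = G 0 := by
  have : Wk 0 = Finset.univ := by
    ext f; simp only [mem_Wk, okW, Finset.mem_univ, iff_true]
    exact ⟨fun k => k.elim0, fun k => k.elim0⟩
  simp [EE, this]

theorem EE_succ (n : ℕ) (G : ℤ × ℤ → ℂ) : EE (n+1) G = EE n (stp G) := by
  simp only [EE, stp]
  simp_rw [← Finset.sum_filter]
  rw [Finset.sum_sigma']
  refine Finset.sum_bij' (fun f _ => ⟨Fin.init f, f (Fin.last n)⟩) (fun x _ => Fin.snoc x.1 x.2) ?_ ?_ ?_ ?_ ?_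
  · intro f hf
    rw [mem_Wk, ← Fin.snoc_init_self f, okW_snoc] at hf
    simp only [Finset.mem_sigma, Finset.mem_filter, mem_Wk]
    exact hf
  · intro x hx
    simp only [Finset.mem_sigma, Finset.mem_filter, mem_Wk] at hx
    rw [mem_Wk, okW_snoc]
    exact hx
  · intro f hf
    simp
  · intro x hx
    simp
  · intro f hf
    rw [Fin.sum_univ_castSucc]
    rfl

theorem EE_congr {n : ℕ} {G H : ℤ × ℤ → ℂ} (h : ∀ p, quad p → G p = H p) : EE n G = EE n H :=
  Finset.sum_congr rfl fun _ hf => h _ (Wk_quad hf)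

theorem EE_swap (n : ℕ) (G : ℤ × ℤ → ℂ) : EE n (fun p => G p.swap) = EE n G := by
  induction n generalizing G with
  | zero => simp [EE_zero]
  | succ n ih =>
    rw [EE_succ, EE_succ, ← ih (stp G)]
    congr 1
    funext p
    simp [stp, stepS, quad, and_comm]
    ring

/-- bivariate walk polynomial -/
noncomputable def Wp (n : ℕ) (x y : ℂ) : ℂ := EE n (fun p => x^p.1.toNat * y^p.2.toNat)
/-- boundary polynomial -/
noncomputable def Ap (n : ℕ) (x : ℂ) : ℂ := EE n (fun p => if p.2 = 0 then x^p.1.toNat else 0)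

theorem Ap_swap (n : ℕ) (y : ℂ) : EE n (fun p => if p.1 = 0 then y^p.2.toNat else 0) = Ap n y := by
  rw [Ap, ← EE_swap]; rfl

theorem stp_kernel (x y : ℂ) (p : ℤ × ℤ) (hp : quad p) :
    x * y * stp (fun p => x^p.1.toNat * y^p.2.toNat) p =
    (y^2 + x*y^2 + x^2*y^2 + x^2*y + x^2) * (x^p.1.toNat * y^p.2.toNat)
      - x^2 * (if p.2 = 0 then x^p.1.toNat else 0) - y^2 * (if p.1 = 0 then y^p.2.toNat else 0) := by
  obtain ⟨i, j⟩ := p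
  obtain ⟨h1, h2⟩ := hp
  simp only at h1 h2
  lift i to ℕ using h1
  lift j to ℕ using h2
  have q1 : quad ((i:ℤ), (j:ℤ)+1) := ⟨by positivity, by positivity⟩
  have q2 : quad ((i:ℤ)+1, (j:ℤ)+1) := ⟨by positivity, by positivity⟩
  have q3 : quad ((i:ℤ)+1, (j:ℤ)) := ⟨by positivity, by positivity⟩
  have s1 : ((i:ℤ)+1).toNat = i+1 := by omega
  have s2 : ((j:ℤ)+1).toNat = j+1 := by omega
  have e : stp (fun p => x^p.1.toNat * y^p.2.toNat) ((i:ℤ),(j:ℤ)) =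
    (if quad ((i:ℤ)+-1, (j:ℤ)+1) then x^((i:ℤ)+-1).toNat * y^(j+1) else 0) +
    (x^i*y^(j+1) + (x^(i+1) * y^(j+1) + (x^(i+1)*y^j +
     (if quad ((i:ℤ)+1, (j:ℤ)+-1) then x^(i+1) * y^((j:ℤ)+-1).toNat else 0)))) := by
    simp only [stp, stepS]
    rw [Finset.sum_insert (by decide), Finset.sum_insert (by decide), Finset.sum_insert (by decide),
      Finset.sum_insert (by decide), Finset.sum_singleton]
    simp only [Prod.mk_add_mk, add_zero, if_pos q1, if_pos q2, if_pos q3, s1, s2, Int.toNat_natCast]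
  have l : x * y * (if quad ((i:ℤ)+-1, (j:ℤ)+1) then x^((i:ℤ)+-1).toNat * y^(j+1) else 0)
      = y^2 * (x^i * y^j) - y^2 * (if (i:ℤ) = 0 then y^j else 0) := by
    cases i with
    | zero => simp [quad]
    | succ i =>
      have : quad (((i+1:ℕ):ℤ)+-1, (j:ℤ)+1) := ⟨by push_cast; omega, by positivity⟩
      have t : (((i+1:ℕ):ℤ)+-1).toNat = i := by omega
      rw [if_pos this, t, if_neg (by positivity)]; ring
  have r : x * y * (if quad ((i:ℤ)+1, (j:ℤ)+-1) then x^(i+1) * y^((j:ℤ)+-1).toNat else 0)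
      = x^2 * (x^i * y^j) - x^2 * (if (j:ℤ) = 0 then x^i else 0) := by
    cases j with
    | zero => simp [quad]
    | succ j =>
      have : quad ((i:ℤ)+1, ((j+1:ℕ):ℤ)+-1) := ⟨by positivity, by push_cast; omega⟩
      have t : (((j+1:ℕ):ℤ)+-1).toNat = j := by omega
      rw [if_pos this, t, if_neg (by positivity)]; ring
  simp only [Int.toNat_natCast]
  rw [e]
  linear_combination l + r

theorem Wp_succ (n : ℕ) (x y : ℂ) : x * y * Wp (n+1) x y =
    (y^2 + x*y^2 + x^2*y^2 + x^2*y + x^2) * Wp n x y - x^2 * Ap n x - y^2 * Ap n y := by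
  rw [Wp, EE_succ, ← Ap_swap n y, Wp, Ap]
  simp only [EE, Finset.mul_sum, ← Finset.sum_sub_distrib]
  exact Finset.sum_congr rfl fun f hf => stp_kernel x y _ (Wk_quad hf)

theorem Wp_zero (x y : ℂ) : Wp 0 x y = 1 := by simp [Wp, EE_zero]

theorem EE_bound {n : ℕ} {G : ℤ × ℤ → ℂ} (h : ∀ p, ‖G p‖ ≤ 1) : ‖EE n G‖ ≤ 5^n := by
  calc ‖EE n G‖ ≤ ∑ f ∈ Wk n, ‖G (∑ j, f j)‖ := norm_sum_le _ _
    _ ≤ ∑ f ∈ Wk n, 1 := Finset.sum_le_sum fun f _ => h _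
    _ = (Wk n).card := by simp
    _ ≤ 5^n := by exact_mod_cast Wk_card_le n

theorem Wp_bound (n : ℕ) {x y : ℂ} (hx : ‖x‖ ≤ 1) (hy : ‖y‖ ≤ 1) : ‖Wp n x y‖ ≤ 5^n := by
  apply EE_bound
  intro p
  rw [norm_mul, norm_pow, norm_pow]
  exact mul_le_one₀ (pow_le_one₀ (norm_nonneg _) hx) (by positivity) (pow_le_one₀ (norm_nonneg _) hy)

theorem Ap_bound (n : ℕ) {x : ℂ} (hx : ‖x‖ ≤ 1) : ‖Ap n x‖ ≤ 5^n := by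
  apply EE_bound
  intro p
  split_ifs
  · rw [norm_pow]; exact pow_le_one₀ (norm_nonneg _) hx
  · simp

theorem Wp_one (n : ℕ) : Wp n 1 1 = (quarterPlaneWalks ({(-1,1),(0,1),(1,1),(1,0),(1,-1)} : Finset (ℤ × ℤ)) n : ℂ) := by
  rw [quarterPlaneWalks_eq]; simp [Wp, EE]

theorem summable_aux {t : ℂ} (ht : ‖t‖ < 1/5) {w : ℕ → ℂ} (hw : ∀ n, ‖w n‖ ≤ 5^n) :
    Summable (fun n => t^n * w n) ∧ ‖∑' n, t^n * w n‖ ≤ (1 - 5 * ‖t‖)⁻¹ := by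
  have h5 : 5 * ‖t‖ < 1 := by linarith
  have hb : ∀ n, ‖t^n * w n‖ ≤ (5 * ‖t‖)^n := by
    intro n
    rw [norm_mul, norm_pow, mul_pow, mul_comm]
    gcongr
    exact hw n
  refine ⟨Summable.of_norm_bounded (summable_geometric_of_lt_one (by positivity) h5) hb, ?_⟩
  exact tsum_of_norm_bounded (hasSum_geometric_of_lt_one (by positivity) h5) hb

/-- boundary generating function -/
noncomputable def FA (t x : ℂ) : ℂ := t * x^2 * ∑' n, t^n * Ap n x
/-- full generating function -/
noncomputable def FW (t x y : ℂ) : ℂ := ∑' n, t^n * Wp n x y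

theorem func_eq {t x y : ℂ} (ht : ‖t‖ < 1/5) (hx : ‖x‖ ≤ 1) (hy : ‖y‖ ≤ 1) :
    (x * y - t * (y^2 + x*y^2 + x^2*y^2 + x^2*y + x^2)) * FW t x y = x * y - FA t x - FA t y := by
  have sW := (summable_aux ht (fun n => Wp_bound n hx hy)).1
  have sx := (summable_aux ht (fun n => Ap_bound n hx)).1
  have sy := (summable_aux ht (fun n => Ap_bound n hy)).1
  have e1 : FW t x y = 1 + ∑' n, t^(n+1) * Wp (n+1) x y := by
    rw [FW, sW.tsum_eq_zero_add]; simp [Wp_zero]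
  have e2 : x * y * ∑' n, t^(n+1) * Wp (n+1) x y =
      t * ((y^2 + x*y^2 + x^2*y^2 + x^2*y + x^2) * FW t x y - x^2 * (∑' n, t^n * Ap n x) - y^2 * (∑' n, t^n * Ap n y)) := by
    rw [FW, ← tsum_mul_left, ← tsum_mul_left, ← tsum_mul_left, ← tsum_mul_left,
      ← (sW.mul_left _).tsum_sub (sx.mul_left _), ← ((sW.mul_left _).sub (sx.mul_left _)).tsum_sub (sy.mul_left _),
      ← tsum_mul_left]
    congr 1
    funext n
    linear_combination t^(n+1) * Wp_succ n x y
  rw [FA, FA]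
  linear_combination (x * y) * e1 + e2

theorem FA_bound {t x : ℂ} (ht : ‖t‖ < 1/5) (hx : ‖x‖ ≤ 1) : ‖FA t x‖ ≤ ‖x‖^2 * (‖t‖ * (1 - 5 * ‖t‖)⁻¹) := by
  have := (summable_aux ht (fun n => Ap_bound n hx)).2
  rw [FA, norm_mul, norm_mul, norm_pow]
  calc ‖t‖ * ‖x‖^2 * ‖∑' n, t^n * Ap n x‖ ≤ ‖t‖ * ‖x‖^2 * (1 - 5 * ‖t‖)⁻¹ := by gcongr
    _ = _ := by ring

open Filter Topology

/-- the counting function -/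
noncomputable def Cf (t : ℂ) : ℂ := FW t 1 1

/-- the parametrisation -/
noncomputable def tF (s : ℂ) : ℂ := s / (1 + s + 3 * s^2)

theorem tF_eq_inv {s : ℂ} (h0 : s ≠ 0) : tF s = (TT s)⁻¹ := by
  have : TT s = (1 + s + 3 * s^2) / s := by rw [TT]; field_simp
  rw [this, inv_div, tF]

theorem TT_small {s : ℂ} (h0 : s ≠ 0) (hs : ‖s‖ ≤ 1/10) : 6 ≤ ‖TT s‖ := by
  have h1 : ‖s⁻¹‖ ≤ ‖TT s‖ + (1 + 3 * ‖s‖) := by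
    have : s⁻¹ = TT s - (1 + 3 * s) := by rw [TT]; ring
    rw [this]
    refine (norm_sub_le _ _).trans ?_
    gcongr
    refine (norm_add_le _ _).trans ?_
    simp
  have h2 : 10 ≤ ‖s⁻¹‖ := by
    rw [norm_inv]
    have : 0 < ‖s‖ := norm_pos_iff.2 h0
    rw [le_inv_comm₀ (by norm_num) this]
    linarith
  linarith

theorem UU_small {s : ℂ} (h0 : s ≠ 0) (hs : ‖s‖ ≤ 1/10) (n : ℕ) :
    2^n ≤ ‖UU n s‖ ∧ 2 * ‖UU n s‖ ≤ ‖UU (n+1) s‖ := by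
  induction n with
  | zero =>
    have e0 : UU 0 s = 1 := rfl
    have e1 : UU (0+1) s = s⁻¹ := rfl
    rw [e0, e1, norm_inv]
    have : 0 < ‖s‖ := norm_pos_iff.2 h0
    refine ⟨by simp, ?_⟩
    rw [norm_one, le_inv_comm₀ (by norm_num) this]
    linarith
  | succ n ih =>
    obtain ⟨i1, i2⟩ := ih
    have h1 : 2^(n+1) ≤ ‖UU (n+1) s‖ := by rw [pow_succ]; linarith
    refine ⟨h1, ?_⟩
    have hT := TT_small h0 hs
    have hge : 1 ≤ ‖UU (n+1) s‖ := le_trans (one_le_pow₀ (by norm_num)) h1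
    have h2 : ‖TT s * UU (n+1) s‖ ≤ ‖UU (n+1+1) s‖ + 1 + ‖UU n s‖ := by
      have : TT s * UU (n+1) s = UU (n+1+1) s + 1 + UU n s := by rw [UU_succ n s]; ring
      rw [this]
      refine (norm_add_le _ _).trans ?_
      gcongr
      refine (norm_add_le _ _).trans ?_
      simp
    rw [norm_mul] at h2
    nlinarith [norm_nonneg (UU n s)]

theorem kernel_pair {s : ℂ} (h0 : s ≠ 0) (hs : ‖s‖ ≤ 1/10) (n : ℕ) :
    FA (tF s) (UU n s)⁻¹ + FA (tF s) (UU (n+1) s)⁻¹ = (UU n s)⁻¹ * (UU (n+1) s)⁻¹ := by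
  have hT := TT_small h0 hs
  have hT0 : TT s ≠ 0 := by intro h; rw [h, norm_zero] at hT; linarith
  have ht : ‖tF s‖ < 1/5 := by
    rw [tF_eq_inv h0, norm_inv, inv_lt_comm₀ (by linarith) (by norm_num)]; linarith
  have b : ∀ n, UU n s ≠ 0 ∧ ‖(UU n s)⁻¹‖ ≤ 1 := by
    intro n
    have h1 : 1 ≤ ‖UU n s‖ := le_trans (one_le_pow₀ (by norm_num)) (UU_small h0 hs n).1
    refine ⟨?_, ?_⟩
    · intro h; rw [h, norm_zero] at h1; linarith
    · rw [norm_inv]; exact inv_le_one_of_one_le₀ h1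
  have fe := func_eq ht (b n).2 (b (n+1)).2
  have hk : (UU n s)⁻¹ * (UU (n+1) s)⁻¹ - tF s * (((UU (n+1) s)⁻¹)^2 + (UU n s)⁻¹*((UU (n+1) s)⁻¹)^2
     + ((UU n s)⁻¹)^2*((UU (n+1) s)⁻¹)^2 + ((UU n s)⁻¹)^2*(UU (n+1) s)⁻¹ + ((UU n s)⁻¹)^2) = 0 := by
    have := seqU_inv s⁻¹ (TT s) (by rw [TT]; field_simp) n
    change UU n s ^2 + UU (n+1) s ^2 + UU n s + UU (n+1) s + 1 = TT s * (UU n s * UU (n+1) s) at this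
    rw [tF_eq_inv h0]
    have n1 := (b n).1
    have n2 := (b (n+1)).1
    field_simp
    linear_combination -this
  rw [hk] at fe
  linear_combination fe

theorem FA_partial {s : ℂ} (h0 : s ≠ 0) (hs : ‖s‖ ≤ 1/10) (n : ℕ) :
    ∑ i ∈ Finset.range n, termF i s = FA (tF s) 1 - (-1)^n * FA (tF s) (UU n s)⁻¹ := by
  induction n with
  | zero => simp [show UU 0 s = 1 from rfl]
  | succ n ih =>
    rw [Finset.sum_range_succ, ih, termF, div_eq_mul_inv, mul_inv, ← kernel_pair h0 hs n]; ring

theorem Ft_small {s : ℂ} (h0 : s ≠ 0) (hs : ‖s‖ ≤ 1/10) : Ft s = FA (tF s) 1 := by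
  have hT := TT_small h0 hs
  have ht : ‖tF s‖ < 1/5 := by
    rw [tF_eq_inv h0, norm_inv, inv_lt_comm₀ (by linarith) (by norm_num)]; linarith
  have b : ∀ n, ‖(UU n s)⁻¹‖ ≤ (1/2)^n := by
    intro n
    rw [norm_inv, one_div, inv_pow]
    exact inv_anti₀ (by positivity) (UU_small h0 hs n).1
  have hsum : Summable (fun n => termF n s) := by
    refine Summable.of_norm_bounded summable_geometric_two (fun n => ?_)
    rw [termF, norm_div, norm_pow, norm_neg, norm_one, one_pow, norm_mul, one_div, mul_inv, ← norm_inv, ← norm_inv]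
    calc _ ≤ (1/2:ℝ)^n * 1 := by
          apply mul_le_mul (b n) _ (norm_nonneg _) (by positivity)
          exact (b (n+1)).trans (pow_le_one₀ (by norm_num) (by norm_num))
      _ = _ := mul_one _
  have h1 := hsum.hasSum.tendsto_sum_nat
  have h2 : Tendsto (fun n => ∑ i ∈ Finset.range n, termF i s) atTop (𝓝 (FA (tF s) 1)) := by
    simp_rw [FA_partial h0 hs]
    have : Tendsto (fun n => (-1)^n * FA (tF s) (UU n s)⁻¹) atTop (𝓝 0) := by
      apply squeeze_zero_norm (a := fun n => (1/2:ℝ)^n * (‖tF s‖ * (1 - 5 * ‖tF s‖)⁻¹))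
      · intro n
        have hle : ‖(UU n s)⁻¹‖ ≤ 1 := (b n).trans (pow_le_one₀ (by norm_num) (by norm_num))
        rw [norm_mul, norm_pow, norm_neg, norm_one, one_pow, one_mul]
        refine (FA_bound ht hle).trans ?_
        have hp : 0 ≤ (1 - 5 * ‖tF s‖)⁻¹ := inv_nonneg.2 (by linarith)
        gcongr
        calc ‖(UU n s)⁻¹‖^2 ≤ ‖(UU n s)⁻¹‖ := by
              rw [pow_two]; exact mul_le_of_le_one_left (norm_nonneg _) hle
          _ ≤ _ := b n
      · have := (tendsto_pow_atTop_nhds_zero_of_lt_one (r := (1/2:ℝ)) (by norm_num) (by norm_num)).mul_const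
          (‖tF s‖ * (1 - 5 * ‖tF s‖)⁻¹)
        simpa using this
    simpa using (tendsto_const_nhds (x := FA (tF s) 1)).sub this
  exact tendsto_nhds_unique h1 h2

/-- the uniformised generating function -/
noncomputable def Phi (s : ℂ) : ℂ := (1 - 2 * Ft s) / (1 - 5 * tF s)

theorem Phi_small {s : ℂ} (h0 : s ≠ 0) (hs : ‖s‖ ≤ 1/10) : Phi s = Cf (tF s) := by
  have hT := TT_small h0 hs
  have ht : ‖tF s‖ < 1/5 := by
    rw [tF_eq_inv h0, norm_inv, inv_lt_comm₀ (by linarith) (by norm_num)]; linarith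
  have fe := func_eq (x := 1) (y := 1) ht (by simp) (by simp)
  have hne : 1 - 5 * tF s ≠ 0 := by
    intro h
    have : tF s = 1/5 := by linear_combination -h/5
    rw [this] at ht; norm_num at ht
  rw [Phi, Ft_small h0 hs, Cf, div_eq_iff hne]
  linear_combination -fe

theorem poles_infinite (Z : Finset ℂ) : ∃ s ∉ Z, s ≠ 0 ∧ s ∈ Om ∧ s^2 ≠ 1/3 ∧ meromorphicOrderAt Ft s < 0 := by
  have hK : ∀ z : ℂ, ∃ K, z ≠ 0 → z ∈ Om → ∀ n ≥ K, UU n z ≠ 0 := by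
    intro z
    by_cases h : z ≠ 0 ∧ z ∈ Om
    · obtain ⟨K, hK⟩ := finite_zeros h.1 h.2
      exact ⟨K, fun _ _ => hK⟩
    · exact ⟨0, fun h1 h2 => absurd ⟨h1, h2⟩ h⟩
  choose K hK using hK
  obtain ⟨s, h0, hr, hτ⟩ := polU_exists_root (500 + Z.sup K)
  set n := 6 * (500 + Z.sup K + 1) with hn
  have hu : UU n s = 0 := by
    rw [polU_eval h0] at hr
    exact (mul_eq_zero.1 hr).resolve_left (pow_ne_zero _ h0)
  have hs : s ∈ Om := by
    by_contra h
    obtain ⟨x, h1, h2, h3, h4⟩ := not_Om h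
    have := seqU_arc_ne h4 h1 h2 n
    rw [← h3] at this
    exact this hu
  refine ⟨s, ?_, h0, hs, s0_not_real h0 hu, Ft_pole h0 hs hu (by omega) hτ⟩
  intro hZ
  have := Finset.le_sup (f := K) hZ
  exact hK s h0 hs n (by omega) hu

open Filter Topology

/-- `f` is represented near `0` by the formal power series `φ`. -/
def SerRep (f : ℂ → ℂ) (φ : PowerSeries ℚ) : Prop :=
  ∀ᶠ z in 𝓝 (0:ℂ), HasSum (fun n => z^n * ((PowerSeries.coeff n φ : ℚ) : ℂ)) (f z)

theorem SerRep.add {f g : ℂ → ℂ} {φ ψ : PowerSeries ℚ} (hf : SerRep f φ) (hg : SerRep g ψ) :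
    SerRep (fun z => f z + g z) (φ + ψ) := by
  filter_upwards [hf, hg] with z h1 h2
  convert! h1.add h2 using 1
  ext n
  simp
  ring

theorem SerRep.zero : SerRep (fun _ => 0) 0 := by
  refine Eventually.of_forall fun z => ?_
  simp

theorem SerRep.sum {ι : Type} (s : Finset ι) (f : ι → ℂ → ℂ) (φ : ι → PowerSeries ℚ)
    (h : ∀ i ∈ s, SerRep (f i) (φ i)) : SerRep (fun z => ∑ i ∈ s, f i z) (∑ i ∈ s, φ i) := by
  classical
  induction s using Finset.induction_on with
  | empty => simpa using SerRep.zero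
  | insert a s ha ih =>
    simp only [Finset.sum_insert ha]
    exact (h a (Finset.mem_insert_self _ _)).add
      (ih fun i hi => h i (Finset.mem_insert_of_mem hi))

theorem SerRep.mul {f g : ℂ → ℂ} {φ ψ : PowerSeries ℚ} (hf : SerRep f φ) (hg : SerRep g ψ) :
    SerRep (fun z => f z * g z) (φ * ψ) := by
  filter_upwards [hf, hg] with z h1 h2
  have s1 := h1.summable.norm
  have s2 := h2.summable.norm
  have e := tsum_mul_tsum_eq_tsum_sum_antidiagonal_of_summable_norm s1 s2
  have s3 := (summable_norm_sum_mul_antidiagonal_of_summable_norm s1 s2).of_norm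
  rw [h1.tsum_eq, h2.tsum_eq] at e
  show HasSum _ (f z * g z)
  rw [e]
  convert! s3.hasSum using 1
  ext n
  rw [PowerSeries.coeff_mul, Rat.cast_sum, Finset.mul_sum]
  refine Finset.sum_congr rfl fun ij hij => ?_
  rw [← Finset.HasAntidiagonal.mem_antidiagonal.1 hij, pow_add]
  push_cast
  ring

theorem SerRep.poly (p : Polynomial ℚ) :
    SerRep (fun z => (p.map (algebraMap ℚ ℂ)).eval z) (p : PowerSeries ℚ) := by
  refine Eventually.of_forall fun z => ?_
  have : (p.map (algebraMap ℚ ℂ)).eval z =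
      ∑ n ∈ Finset.range (p.natDegree + 1), z^n * ((PowerSeries.coeff n (p : PowerSeries ℚ) : ℚ) : ℂ) := by
    rw [Polynomial.eval_map, Polynomial.eval₂_eq_sum_range]
    refine Finset.sum_congr rfl fun n _ => ?_
    simp [mul_comm]
  show HasSum _ ((p.map (algebraMap ℚ ℂ)).eval z)
  rw [this]
  refine hasSum_sum_of_ne_finset_zero fun n hn => ?_
  have : p.coeff n = 0 := Polynomial.coeff_eq_zero_of_natDegree_lt (by simpa [Nat.lt_succ_iff] using hn)
  simp [this]

theorem SerRep.fps {f : ℂ → ℂ} {φ : PowerSeries ℚ} (hf : SerRep f φ) :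
    HasFPowerSeriesAt f
      (FormalMultilinearSeries.ofScalars ℂ (fun n => ((PowerSeries.coeff n φ : ℚ) : ℂ))) 0 := by
  rw [hasFPowerSeriesAt_iff]
  simpa [FormalMultilinearSeries.coeff_ofScalars, SerRep] using hf

theorem SerRep.analyticAt {f : ℂ → ℂ} {φ : PowerSeries ℚ} (hf : SerRep f φ) : AnalyticAt ℂ f 0 :=
  ⟨_, hf.fps⟩

theorem SerRep.coeff_eq {f : ℂ → ℂ} {φ : PowerSeries ℚ} (hf : SerRep f φ) (n : ℕ) :
    ((PowerSeries.coeff n φ : ℚ) : ℂ) = iteratedDeriv n f 0 / n.factorial := by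
  have := hf.fps.eq_formalMultilinearSeries hf.analyticAt.hasFPowerSeriesAt
  have h2 := congrArg (fun q => FormalMultilinearSeries.coeff q n) this
  simpa [FormalMultilinearSeries.coeff_ofScalars] using h2

theorem SerRep.deriv {f : ℂ → ℂ} {φ : PowerSeries ℚ} (hf : SerRep f φ) :
    SerRep (deriv f) (PowerSeries.derivative ℚ φ) := by
  have h := (hasFPowerSeriesAt_iff.1 hf.analyticAt.deriv.hasFPowerSeriesAt)
  filter_upwards [h] with z hz
  rw [zero_add] at hz
  convert! hz using 1
  ext n
  rw [PowerSeries.coeff_derivative, FormalMultilinearSeries.coeff_ofScalars, smul_eq_mul]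
  congr 1
  push_cast
  rw [hf.coeff_eq (n+1), iteratedDeriv_succ', Nat.factorial_succ]
  have h1 : ((n:ℂ) + 1) ≠ 0 := by exact_mod_cast Nat.succ_ne_zero n
  have h2 : ((n.factorial : ℕ) : ℂ) ≠ 0 := by exact_mod_cast n.factorial_ne_zero
  push_cast
  field_simp

set_option linter.deprecated false in
theorem SerRep.iter {f : ℂ → ℂ} {φ : PowerSeries ℚ} (hf : SerRep f φ) (i : ℕ) :
    SerRep (_root_.deriv^[i] f) (PowerSeries.derivativeFun^[i] φ) := by
  induction i with
  | zero => exact hf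
  | succ i ih =>
    rw [Function.iterate_succ_apply', Function.iterate_succ_apply']
    exact ih.deriv

theorem SerRep_Cf : SerRep Cf (walkGF ({(-1,1),(0,1),(1,1),(1,0),(1,-1)} : Finset (ℤ × ℤ))) := by
  have : Metric.ball (0:ℂ) (1/5) ∈ 𝓝 (0:ℂ) := Metric.ball_mem_nhds _ (by norm_num)
  filter_upwards [this] with z hz
  rw [mem_ball_zero_iff] at hz
  have h := (summable_aux hz (fun n => Wp_bound n (x := 1) (y := 1) (by simp) (by simp))).1.hasSum
  convert! h using 1
  ext n
  rw [Wp_one, walkGF, PowerSeries.coeff_mk]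
  push_cast
  rfl

set_option linter.deprecated false in
theorem ode_Cf {r : ℕ} {p : ℕ → Polynomial ℚ}
    (h : ∑ i ∈ Finset.range (r + 1), (p i : PowerSeries ℚ) *
          (PowerSeries.derivativeFun^[i] (walkGF ({(-1,1),(0,1),(1,1),(1,0),(1,-1)} : Finset (ℤ × ℤ)))) = 0) :
    ∀ᶠ z in 𝓝 (0:ℂ), ∑ i ∈ Finset.range (r + 1),
      ((p i).map (algebraMap ℚ ℂ)).eval z * (deriv^[i] Cf) z = 0 := by
  have h1 := SerRep.sum (Finset.range (r+1)) _ _ (fun i _ => (SerRep.poly (p i)).mul (SerRep_Cf.iter i))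
  rw [h] at h1
  filter_upwards [h1, SerRep.zero] with z a b
  exact a.unique b

open Filter Topology

theorem tF_den {s : ℂ} (hs : s ∈ Om) : 1 + s + 3 * s^2 ≠ 0 := by
  rcases eq_or_ne s 0 with h0 | h0
  · simp [h0]
  · have h1 := (Om_facts h0 hs).1
    have : 1 + s + 3 * s^2 = TT s * s := by rw [TT]; field_simp
    rw [this]
    exact mul_ne_zero h1 h0

theorem tF_analyticAt {s : ℂ} (hs : s ∈ Om) : AnalyticAt ℂ tF s := by
  have h := tF_den hs
  unfold tF
  fun_prop (disch := assumption)

theorem tF_deriv {s : ℂ} (hs : s ∈ Om) : deriv tF s = (1 - 3 * s^2) / (1 + s + 3 * s^2)^2 := by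
  have h := tF_den hs
  have h1 : HasDerivAt (fun s : ℂ => 1 + s + 3 * s^2) (1 + 3 * (2 * s)) s := by
    have a := ((hasDerivAt_id s).const_add 1).add (((hasDerivAt_pow 2 s)).const_mul 3)
    convert! a using 1
    simp
  have h2 := ((hasDerivAt_id s).div h1 h).deriv
  have h3 : deriv tF s = (1 * (1 + s + 3 * s^2) - s * (1 + 3 * (2 * s))) / (1 + s + 3 * s^2)^2 := h2
  rw [h3]
  congr 1
  ring

theorem zero_mem_Om : (0:ℂ) ∈ Om := by
  left
  simp

theorem Phi_near_zero : Phi =ᶠ[𝓝[≠] 0] fun s => Cf (tF s) := by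
  have : Metric.closedBall (0:ℂ) (1/10) ∈ 𝓝 (0:ℂ) := Metric.closedBall_mem_nhds _ (by norm_num)
  filter_upwards [self_mem_nhdsWithin, mem_nhdsWithin_of_mem_nhds this] with s h0 hs
  exact Phi_small h0 (by simpa using hs)

theorem tF_zero : tF 0 = 0 := by simp [tF]

theorem Phi_mero {s : ℂ} (hs : s ∈ Om) : MeromorphicAt Phi s := by
  rcases eq_or_ne s 0 with h0 | h0
  · subst h0
    rw [MeromorphicAt.meromorphicAt_congr Phi_near_zero]
    have h1 : AnalyticAt ℂ Cf (tF 0) := by rw [tF_zero]; exact SerRep_Cf.analyticAt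
    exact (h1.comp (tF_analyticAt hs)).meromorphicAt
  · have h1 := meromorphicAt_Ft h0 hs
    have h2 := (tF_analyticAt hs).meromorphicAt
    unfold Phi
    fun_prop

/-- derivation with respect to `t` in the variable `s` -/
noncomputable def dl (g : ℂ → ℂ) : ℂ → ℂ := (deriv tF)⁻¹ * deriv g

theorem dl_mero {g : ℂ → ℂ} {s : ℂ} (hs : s ∈ Om) (hg : MeromorphicAt g s) (i : ℕ) :
    MeromorphicAt (dl^[i] g) s := by
  induction i with
  | zero => exact hg
  | succ i ih =>
    rw [Function.iterate_succ_apply']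
    exact (tF_analyticAt hs).deriv.meromorphicAt.inv.mul ih.deriv

theorem dl_transfer (i : ℕ) : dl^[i] Phi =ᶠ[𝓝[≠] 0] fun s => (deriv^[i] Cf) (tF s) := by
  induction i with
  | zero => exact Phi_near_zero
  | succ i ih =>
    have ht := tF_analyticAt zero_mem_Om
    have hA : ∀ᶠ s in 𝓝 (0:ℂ), AnalyticAt ℂ (deriv^[i] Cf) (tF s) := by
      have h1 : ∀ᶠ t in 𝓝 (tF 0), AnalyticAt ℂ (deriv^[i] Cf) t := by
        rw [tF_zero]
        exact (SerRep_Cf.iter i).analyticAt.eventually_analyticAt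
      exact ht.continuousAt.eventually h1
    have hB := ht.eventually_analyticAt
    have hC : ∀ᶠ s in 𝓝 (0:ℂ), deriv tF s ≠ 0 := by
      refine ht.deriv.continuousAt.eventually_ne ?_
      rw [tF_deriv zero_mem_Om]
      simp
    filter_upwards [ih.nhdsNE_deriv, nhdsWithin_le_nhds hA, nhdsWithin_le_nhds hB,
      nhdsWithin_le_nhds hC] with s h1 h2 h3 h4
    rw [Function.iterate_succ_apply', Function.iterate_succ_apply']
    show (deriv tF s)⁻¹ * deriv (dl^[i] Phi) s = _
    rw [h1]
    have := deriv_comp (x := s) (h₂ := deriv^[i] Cf) (h := tF) h2.differentiableAt h3.differentiableAt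
    have e : deriv (fun s => (deriv^[i] Cf) (tF s)) s = deriv (deriv^[i] Cf) (tF s) * deriv tF s := this
    rw [e]
    field_simp

theorem dl_order {s : ℂ} (hs : s ∈ Om) (h3 : s^2 ≠ 1/3) {g : ℂ → ℂ} {m : ℤ} (hm : m < 0)
    (hg : meromorphicOrderAt g s = m) (i : ℕ) :
    meromorphicOrderAt (dl^[i] g) s = ((m - i : ℤ) : WithTop ℤ) := by
  induction i with
  | zero => simpa using hg
  | succ i ih =>
    rw [Function.iterate_succ_apply']
    have hd : deriv tF s ≠ 0 := by
      rw [tF_deriv hs]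
      refine div_ne_zero ?_ (pow_ne_zero _ (tF_den hs))
      intro h
      apply h3
      linear_combination (-1/3) * h
    show meromorphicOrderAt ((deriv tF)⁻¹ * deriv (dl^[i] g)) s = _
    rw [meromorphicOrderAt_mul_of_ne_zero ((tF_analyticAt hs).deriv.inv hd) (by simpa using hd)]
    rw [meromorphicOrderAt_deriv_eq_sub_one (n := m - i) ?_ ih]
    · congr 1
      push_cast
      ring
    · have : m - i ≠ 0 := by omega
      exact_mod_cast this

theorem Phi_pole {s : ℂ} (h0 : s ≠ 0) (hs : s ∈ Om) (hF : meromorphicOrderAt Ft s < 0) :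
    meromorphicOrderAt Phi s < 0 := by
  by_contra hcon
  obtain ⟨G, hG, hGe⟩ := order_nonneg_ext (Phi_mero hs) hcon
  have ht := tF_analyticAt hs
  have hA : AnalyticAt ℂ (fun z => (1 - G z * (1 - 5 * tF z)) / 2) s := by fun_prop
  have hfin : ({z : ℂ | z = 1 ∨ z = 1/3} \ {s}).Finite :=
    Set.Finite.subset ((Set.finite_singleton (1:ℂ)).union (Set.finite_singleton (1/3:ℂ)))
      (by rintro z ⟨hz, -⟩; simpa [or_comm] using hz)
  have hcl : ∀ᶠ z in 𝓝 s, z ∉ ({z : ℂ | z = 1 ∨ z = 1/3} \ {s}) :=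
    hfin.isClosed.isOpen_compl.mem_nhds (by simp)
  have e : Ft =ᶠ[𝓝[≠] s] fun z => (1 - G z * (1 - 5 * tF z)) / 2 := by
    filter_upwards [hGe, self_mem_nhdsWithin, nhdsWithin_le_nhds hcl,
      nhdsWithin_le_nhds (Om_isOpen.mem_nhds hs)] with z h1 h2 h3 h4
    have hd := tF_den h4
    have hne : 1 - 5 * tF z ≠ 0 := by
      intro h
      apply h3
      refine ⟨?_, h2⟩
      have : (3 * z - 1) * (z - 1) = 0 := by
        have h5 : tF z * (1 + z + 3 * z^2) = z := by rw [tF]; exact div_mul_cancel₀ _ hd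
        linear_combination (1 + z + 3 * z^2) * h + 5 * h5
      rcases mul_eq_zero.1 this with h | h
      · right; linear_combination h / 3
      · left; linear_combination h
    rw [← h1, Phi]
    field_simp
    ring
  rw [meromorphicOrderAt_congr e] at hF
  exact absurd hA.meromorphicOrderAt_nonneg (not_le.2 hF)

theorem sum_order {s : ℂ} (n : ℕ) (f : ℕ → ℂ → ℂ) (m : ℤ) (hf : ∀ i, MeromorphicAt (f i) s)
    (h : ∀ i < n, (m : WithTop ℤ) < meromorphicOrderAt (f i) s) :
    MeromorphicAt (∑ i ∈ Finset.range n, f i) s ∧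
      (m : WithTop ℤ) < meromorphicOrderAt (∑ i ∈ Finset.range n, f i) s := by
  induction n with
  | zero =>
    have : meromorphicOrderAt (0 : ℂ → ℂ) s = ⊤ := by
      rw [meromorphicOrderAt_eq_top_iff]
      simp
    simp only [Finset.range_zero, Finset.sum_empty, this]
    exact ⟨analyticAt_const.meromorphicAt, WithTop.coe_lt_top m⟩
  | succ n ih =>
    obtain ⟨h1, h2⟩ := ih fun i hi => h i (by omega)
    rw [Finset.sum_range_succ]
    exact ⟨h1.add (hf n), lt_of_lt_of_le (lt_min h2 (h n (by omega)))
      (meromorphicOrderAt_add h1 (hf n))⟩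

theorem bad_finite (q : Polynomial ℂ) (hq : q ≠ 0) : ∃ Z : Finset ℂ, ∀ s ∉ Z, s ≠ 0 → s ∈ Om →
    q.eval (tF s) ≠ 0 := by
  classical
  let R : ℂ → Polynomial ℂ := fun w =>
    Polynomial.C (3 * w) * Polynomial.X^2 + Polynomial.C (w - 1) * Polynomial.X + Polynomial.C w
  refine ⟨q.roots.toFinset.biUnion fun w => (R w).roots.toFinset, fun s hsZ h0 hs hev => ?_⟩
  apply hsZ
  have hd := tF_den hs
  have hw : tF s ≠ 0 := by rw [tF]; exact div_ne_zero h0 hd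
  rw [Finset.mem_biUnion]
  refine ⟨tF s, by simpa [hq] using hev, ?_⟩
  have hR : R (tF s) ≠ 0 := by
    intro h
    have := congrArg (Polynomial.eval 0) h
    simp [R] at this
    exact hw this
  have hz : (R (tF s)).eval s = 0 := by
    simp only [R, Polynomial.eval_add, Polynomial.eval_mul, Polynomial.eval_C, Polynomial.eval_pow,
      Polynomial.eval_X]
    rw [tF]
    field_simp
    ring
  simpa [hR] using hz

set_option linter.deprecated false in
theorem main_step {r : ℕ} {p : ℕ → Polynomial ℚ} (hr : p r ≠ 0)
    (h : ∑ i ∈ Finset.range (r + 1), (p i : PowerSeries ℚ) *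
          (PowerSeries.derivativeFun^[i] (walkGF ({(-1,1),(0,1),(1,1),(1,0),(1,-1)} : Finset (ℤ × ℤ)))) = 0) :
    False := by
  let q : ℕ → Polynomial ℂ := fun i => (p i).map (algebraMap ℚ ℂ)
  let f : ℕ → ℂ → ℂ := fun i => (fun s => (q i).eval (tF s)) * dl^[i] Phi
  have hqa : ∀ i, ∀ s ∈ Om, AnalyticAt ℂ (fun s => (q i).eval (tF s)) s := fun i s hs =>
    (AnalyticAt.aeval_polynomial (tF_analyticAt hs) (q i))
  have hfm : ∀ s ∈ Om, ∀ i, MeromorphicAt (f i) s := fun s hs i =>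
    (hqa i s hs).meromorphicAt.mul (dl_mero hs (Phi_mero hs) i)
  have hL : MeromorphicOn (∑ i ∈ Finset.range (r+1), f i) Om := by
    intro s hs
    have := hfm s hs
    exact MeromorphicAt.sum fun i _ => this i
  have h0 : meromorphicOrderAt (∑ i ∈ Finset.range (r+1), f i) 0 = ⊤ := by
    rw [meromorphicOrderAt_eq_top_iff]
    have ho : ∀ᶠ s in 𝓝 (0:ℂ), ∑ i ∈ Finset.range (r + 1),
        (q i).eval (tF s) * (deriv^[i] Cf) (tF s) = 0 := by
      have h1 : Tendsto tF (𝓝 0) (𝓝 0) := by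
        have := (tF_analyticAt zero_mem_Om).continuousAt.tendsto
        rwa [tF_zero] at this
      exact h1.eventually (ode_Cf h)
    have ha : ∀ᶠ s in 𝓝[≠] (0:ℂ), ∀ i ∈ Finset.range (r+1),
        (dl^[i] Phi) s = (deriv^[i] Cf) (tF s) := by
      rw [Filter.eventually_all_finset]
      exact fun i _ => dl_transfer i
    filter_upwards [ha, nhdsWithin_le_nhds ho] with s h1 h2
    rw [Finset.sum_apply, ← h2]
    refine Finset.sum_congr rfl fun i hi => ?_
    simp only [f, Pi.mul_apply]
    rw [h1 i hi]
  obtain ⟨Z, hZ⟩ := bad_finite (q r) (by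
    simpa [q, Polynomial.map_eq_zero_iff (algebraMap ℚ ℂ).injective] using hr)
  obtain ⟨s, hsZ, hs0, hs, hs3, hpole⟩ := poles_infinite Z
  have hP := Phi_pole hs0 hs hpole
  obtain ⟨m, hm⟩ := WithTop.ne_top_iff_exists.1 hP.ne_top
  have hm0 : m < 0 := by rw [← hm] at hP; exact_mod_cast hP
  have hord := dl_order hs hs3 hm0 hm.symm
  have hlow := sum_order (s := s) r f (m - r) (hfm s hs) (by
    intro i hi
    simp only [f]
    rw [meromorphicOrderAt_mul (hqa i s hs).meromorphicAt (dl_mero hs (Phi_mero hs) i), hord i]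
    refine lt_of_lt_of_le ?_ (le_add_of_nonneg_left (hqa i s hs).meromorphicOrderAt_nonneg)
    exact_mod_cast (by omega : m - r < m - i))
  have htop : meromorphicOrderAt (f r) s = ((m - r : ℤ) : WithTop ℤ) := by
    simp only [f]
    rw [meromorphicOrderAt_mul_of_ne_zero (hqa r s hs) (hZ s hsZ hs0 hs), hord r]
  have hfin : meromorphicOrderAt (∑ i ∈ Finset.range (r+1), f i) s ≠ ⊤ := by
    rw [Finset.sum_range_succ, meromorphicOrderAt_add_eq_right_of_lt hlow.1 (by rw [htop]; exact hlow.2), htop]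
    exact WithTop.coe_ne_top
  exact hL.meromorphicOrderAt_ne_top_of_isPreconnected Om_isPreconnected hs zero_mem_Om hfin h0

theorem modelC_not_DFinite :
    ¬ ∃ (r : ℕ) (p : ℕ → Polynomial ℚ),
      (∃ i, i ≤ r ∧ p i ≠ 0) ∧
      ∑ i ∈ Finset.range (r + 1),
        (p i : PowerSeries ℚ) *
          (PowerSeries.derivativeFun^[i] (walkGF ({(-1,1),(0,1),(1,1),(1,0),(1,-1)} : Finset (ℤ × ℤ)))) = 0 := by
  rintro ⟨r, p, ⟨i, hi, hp⟩, h⟩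
  induction r with
  | zero =>
    obtain rfl : i = 0 := by omega
    exact main_step hp h
  | succ r ih =>
    by_cases hr : p (r+1) = 0
    · have hir : i ≤ r := by
        rcases Nat.lt_or_ge r i with h1 | h1
        · obtain rfl : i = r + 1 := by omega
          exact absurd hr hp
        · exact h1
      refine ih ?_ hir
      rw [Finset.sum_range_succ, hr] at h
      simpa using h
    · exact main_step hr h
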